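/- arXiv:0811.2735 — 2 statements merged into one kernel-verified Lean document; each statement's English description precedes it below -/
import Mathlib

section
/- Let q ≥ 3 be an integer. If h = 0 and β = β_c, then f_{β_c,0} has exactly q + 1 global minimizers on Ω: the symmetric vector (1/q, …, 1/q) together with the q coordinate permutations of ((q−1)/q, 1/(q(q−1)), …, 1/(q(q−1))). -/
open Real Filter Finset

/-- The simplex `Ω = {x ∈ ℝ^q : x_1 + ⋯ + x_q = 1, x_i ≥ 0}`. -/
def simplex (q : ℕ) : Set (Fin q → ℝ) := {x | (∀ i, 0 ≤ x i) ∧ ∑ i, x i = 1}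

/-- The Curie–Weiss Potts free energy. -/
noncomputable def freeEnergy (q : ℕ) [NeZero q] (β h : ℝ) (x : Fin q → ℝ) : ℝ :=
  ∑ i, x i * Real.log (x i) - β / 2 * ∑ i, x i ^ 2 - h * x 0

/-- The critical inverse temperature `β_c` for `q > 2`. -/
noncomputable def betaC (q : ℕ) : ℝ :=
  2 * ((q : ℝ) - 1) / ((q : ℝ) - 2) * Real.log ((q : ℝ) - 1)

/-- The asymmetric vector `((q−1)/q, 1/(q(q−1)), …, 1/(q(q−1)))`. -/
noncomputable def xasym (q : ℕ) [NeZero q] : Fin q → ℝ :=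
  fun i => if i = 0 then ((q : ℝ) - 1) / q else 1 / (q * ((q : ℝ) - 1))

lemma strictConcaveOn_log_one_sub_sub_log {κ : ℝ} :
    StrictConcaveOn ℝ (Set.Ico (1/2 : ℝ) 1)
      (fun x => log (1 - x) - log x + 2 * κ * (x - 1 / 2)) := by
  have hder : ∀ x ∈ Set.Ioo (1/2 : ℝ) 1,
      HasDerivAt (fun x => log (1 - x) - log x + 2 * κ * (x - 1 / 2))
        (-1 / (1 - x) - 1 / x + 2 * κ) x := by
    intro x hx
    have h1 : HasDerivAt (fun x : ℝ => 1 - x) (-1) x := by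
      simpa using (hasDerivAt_id x).const_sub 1
    have h2 := (h1.log (by linarith [hx.2])).sub ((hasDerivAt_id x).log (by simp; linarith [hx.1]))
    have h3 := h2.add (((hasDerivAt_id x).sub_const (1/2)).const_mul (2 * κ))
    refine h3.congr_deriv ?_
    simp
  apply StrictAntiOn.strictConcaveOn_of_deriv (convex_Ico _ _)
  · apply ContinuousOn.add
    · apply ContinuousOn.sub
      · exact ContinuousOn.log (by fun_prop) (fun x hx => by linarith [hx.2])
      · exact ContinuousOn.log (by fun_prop) (fun x hx => by linarith [hx.1])
    · fun_prop
  · rw [interior_Ico]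
    intro x hx y hy hxy
    rw [(hder x hx).deriv, (hder y hy).deriv]
    have e : ∀ z ∈ Set.Ioo (1/2 : ℝ) 1, -1 / (1 - z) - 1 / z = - (1 / (z * (1 - z))) := by
      intro z hz
      have : 1 - z ≠ 0 := by linarith [hz.2]
      have : z ≠ 0 := by linarith [hz.1]
      field_simp
      ring
    rw [e x hx, e y hy]
    have : 1 / (x * (1 - x)) < 1 / (y * (1 - y)) := by
      apply one_div_lt_one_div_of_lt
      · exact mul_pos (by linarith [hy.1]) (by linarith [hy.2])
      · nlinarith [hx.1, hy.1]
    linarith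

/-- The double-well maximum principle for binary entropy plus a quadratic. -/
lemma binEntropy_add_sq_lt {κ p a : ℝ} (hp : 1 / 2 < p) (hp1 : p < 1)
    (hκ : 2 * κ * (p - 1 / 2) = log p - log (1 - p))
    (ha : a ∈ Set.Icc (0 : ℝ) 1) (h1 : a ≠ p) (h2 : a ≠ 1 - p) :
    binEntropy a + κ * (a - 1 / 2) ^ 2 < binEntropy p + κ * (p - 1 / 2) ^ 2 := by
  wlog h : 1 / 2 ≤ a generalizing a
  · have := this (a := 1 - a) ⟨by linarith [ha.2], by linarith [ha.1]⟩
      (fun h => h2 (by linarith)) (fun h => h1 (by linarith)) (by linarith)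
    rw [binEntropy_one_sub] at this
    convert this using 2
    ring
  have hconc := strictConcaveOn_log_one_sub_sub_log (κ := κ)
  have hd : ∀ x ∈ Set.Ioo (1/2 : ℝ) 1,
      HasDerivAt (fun x => binEntropy x + κ * (x - 1 / 2) ^ 2)
        (log (1 - x) - log x + 2 * κ * (x - 1 / 2)) x := by
    intro x hx
    have := (hasDerivAt_binEntropy (p := x) (by linarith [hx.1]) (by linarith [hx.2])).add
      ((((hasDerivAt_id x).sub_const (1/2)).pow 2).const_mul κ)
    refine this.congr_deriv ?_
    simp
    ring
  have hcont : Continuous (fun x => binEntropy x + κ * (x - 1 / 2) ^ 2) := by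
    have := binEntropy_continuous
    fun_prop
  have hN0 : log (1 - (1/2 : ℝ)) - log (1/2) + 2 * κ * (1/2 - 1 / 2) = 0 := by norm_num
  have hNp : log (1 - p) - log p + 2 * κ * (p - 1 / 2) = 0 := by linarith
  rcases lt_or_gt_of_ne h1 with hlt | hgt
  · have hm : StrictMonoOn (fun x => binEntropy x + κ * (x - 1 / 2) ^ 2) (Set.Icc (1/2) p) := by
      apply strictMonoOn_of_deriv_pos (convex_Icc _ _) hcont.continuousOn
      rw [interior_Icc]
      intro x hx
      rw [(hd x ⟨hx.1, hx.2.trans hp1⟩).deriv]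
      have := hconc.slope_anti_adjacent (x := 1/2) (y := x) (z := p) ⟨le_rfl, by norm_num⟩
        ⟨hp.le, hp1⟩ hx.1 hx.2
      simp only [hN0, hNp] at this
      by_contra! hneg
      have h3 := div_nonneg (sub_nonneg.2 hneg) (sub_pos.2 hx.2).le
      have h4 := div_nonpos_of_nonpos_of_nonneg (sub_nonpos.2 hneg) (sub_pos.2 hx.1).le
      linarith
    exact hm ⟨h, hlt.le⟩ ⟨hp.le, le_rfl⟩ hlt
  · have hm : StrictAntiOn (fun x => binEntropy x + κ * (x - 1 / 2) ^ 2) (Set.Icc p 1) := by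
      apply strictAntiOn_of_deriv_neg (convex_Icc _ _) hcont.continuousOn
      rw [interior_Icc]
      intro x hx
      rw [(hd x ⟨hp.trans hx.1, hx.2⟩).deriv]
      have := hconc.slope_anti_adjacent (x := 1/2) (y := p) (z := x) ⟨le_rfl, by norm_num⟩
        ⟨(hp.trans hx.1).le, hx.2⟩ hp hx.1
      simp only [hN0, hNp, sub_zero, zero_div] at this
      by_contra! hneg
      have h3 := div_nonneg hneg (sub_pos.2 hx.1).le
      linarith
    exact hm ⟨le_rfl, hp1.le⟩ ⟨hgt.le, ha.2⟩ hgt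

lemma log_le_half_sub_inv {r : ℝ} (hr : 1 ≤ r) : log r ≤ (r - r⁻¹) / 2 := by
  rw [← Real.sinh_log (by linarith)]
  exact self_le_sinh_iff.2 (log_nonneg hr)

/-- The ratio `(r log r - r + 1) / (r - 1)^2` decreases. -/
lemma mul_log_ratio_antitoneOn :
    AntitoneOn (fun r : ℝ => (r * log r - r + 1) / (r - 1) ^ 2) (Set.Ioi 1) := by
  have hd : ∀ r ∈ Set.Ioi (1 : ℝ), HasDerivAt (fun r : ℝ => (r * log r - r + 1) / (r - 1) ^ 2)
      ((log r * (r - 1) ^ 2 - (r * log r - r + 1) * (2 * (r - 1))) / ((r - 1) ^ 2) ^ 2) r := by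
    intro r hr
    have hr' : (1 : ℝ) < r := hr
    have h1 : HasDerivAt (fun r : ℝ => r * log r - r + 1) (log r) r := by
      have := ((hasDerivAt_mul_log (x := r) (by linarith)).sub (hasDerivAt_id r)).add_const (1 : ℝ)
      exact this.congr_deriv (by ring)
    have h2 : HasDerivAt (fun r : ℝ => (r - 1) ^ 2) (2 * (r - 1)) r := by
      exact (((hasDerivAt_id r).sub_const 1).pow 2).congr_deriv (by simp)
    exact h1.div h2 (by have : r - 1 ≠ 0 := by linarith
                        positivity)
  apply antitoneOn_of_deriv_nonpos (convex_Ioi _)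
  · exact fun r hr => (hd r hr).continuousAt.continuousWithinAt
  · rw [interior_Ioi]
    exact fun r hr => (hd r hr).differentiableAt.differentiableWithinAt
  · rw [interior_Ioi]
    intro r hr
    rw [(hd r hr).deriv]
    have hr' : (1 : ℝ) < r := hr
    apply div_nonpos_of_nonpos_of_nonneg _ (by positivity)
    have h := le_log_one_add_of_nonneg (x := r - 1) (by linarith)
    rw [show 1 + (r - 1) = r by ring, div_le_iff₀ (by linarith)] at h
    nlinarith

/-- A quadratic below `r log r - r + 1` at some `R > 1` is below it on all of `[0, R]`. -/
lemma sq_lt_mul_log {c r R : ℝ} (hR : 1 < R) (hc : c * (R - 1) ^ 2 < R * log R - R + 1)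
    (hr0 : 0 ≤ r) (hrR : r ≤ R) (hr1 : r ≠ 1) : c * (r - 1) ^ 2 < r * log r - r + 1 := by
  rcases lt_or_gt_of_ne hr1 with h | h
  · have hc' : c < 1 / 2 := by
      have h1 := log_le_half_sub_inv hR.le
      have h2 : R * log R ≤ (R ^ 2 - 1) / 2 := by
        calc R * log R ≤ R * ((R - R⁻¹) / 2) := by gcongr
          _ = _ := by field_simp
      have h3 : 0 < (R - 1) ^ 2 := by have := sub_pos.2 hR; positivity
      by_contra! h4
      nlinarith
    have h5 : 0 < (r - 1) ^ 2 := by have := sub_ne_zero.2 hr1; positivity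
    rcases hr0.eq_or_lt with rfl | h0
    · simp; linarith
    have h6 := log_le_half_sub_inv ((one_le_inv₀ h0).2 h.le)
    rw [log_inv, inv_inv] at h6
    have h7 : (r ^ 2 - 1) / 2 ≤ r * log r := by
      calc (r ^ 2 - 1) / 2 = r * ((r - r⁻¹) / 2) := by field_simp
        _ ≤ _ := by gcongr; linarith
    nlinarith
  · have := mul_log_ratio_antitoneOn (Set.mem_Ioi.2 h) (Set.mem_Ioi.2 hR) hrR
    simp only at this
    rw [← lt_div_iff₀ (by have := sub_pos.2 hR; positivity)] at hc
    rw [← lt_div_iff₀ (by have := sub_pos.2 h; positivity)]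
    linarith

lemma mul_log_sub_mul_log_avg_lt {n r : ℝ} (hn : 0 < n) (hr : 1 < r) :
    (n + 1) * (r * log r - (r + n) * log ((r + n) / (n + 1))) < n * (r * log r - r + 1) := by
  have hd : ∀ x ∈ Set.Ici (1 : ℝ), HasDerivAt (fun r : ℝ => n * (r * log r - r + 1) -
      (n + 1) * (r * log r - (r + n) * log ((r + n) / (n + 1))))
      ((n + 1) * log ((x + n) / (n + 1)) - log x) x := by
    intro x hx
    have hx' : (1 : ℝ) ≤ x := hx
    have h1 := hasDerivAt_mul_log (x := x) (by linarith)
    have h2 : HasDerivAt (fun r : ℝ => (r + n) / (n + 1)) (1 / (n + 1)) x :=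
      ((hasDerivAt_id x).add_const n).div_const _
    have h3 := ((hasDerivAt_id x).add_const n).mul (h2.log (by positivity))
    have h4 := (((h1.sub (hasDerivAt_id x)).add_const 1).const_mul n).sub
      ((h1.sub h3).const_mul (n + 1))
    refine h4.congr_deriv ?_
    have : x + n ≠ 0 := by linarith
    simp
    field_simp
    ring
  have hm : StrictMonoOn (fun r : ℝ => n * (r * log r - r + 1) -
      (n + 1) * (r * log r - (r + n) * log ((r + n) / (n + 1)))) (Set.Ici 1) := by
    apply strictMonoOn_of_deriv_pos (convex_Ici _)
      (fun r hr => (hd r hr).continuousAt.continuousWithinAt)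
    rw [interior_Ici]
    intro x hx
    have hx' : (1 : ℝ) < x := hx
    rw [(hd x hx'.le).deriv]
    have := strictConcaveOn_log_Ioi.2 (Set.mem_Ioi.2 (show 0 < x by linarith))
      (Set.mem_Ioi.2 one_pos) hx'.ne' (show 0 < 1 / (n + 1) by positivity)
      (show 0 < n / (n + 1) by positivity) (by field_simp; ring)
    simp only [smul_eq_mul, log_one, mul_zero, add_zero, mul_one] at this
    rw [one_div_mul_eq_div, one_div_mul_eq_div, ← add_div, div_lt_iff₀ (by positivity)] at this
    linarith
  have := hm Set.self_mem_Ici (Set.mem_Ici.2 hr.le) hr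
  have h1 : (1 + n) / (n + 1) = 1 := by field_simp; ring
  simp [h1] at this
  linarith

/-- The free energy of a vector with one coordinate `a` and `q - 1` equal remaining coordinates. -/
noncomputable def twoLevelEnergy (q : ℕ) (β a : ℝ) : ℝ :=
  a * log a + (1 - a) * log ((1 - a) / (q - 1)) - β / 2 * (a ^ 2 + (1 - a) ^ 2 / (q - 1))

/-- The probability vector with `i`-th coordinate `a` and equal remaining coordinates. -/
noncomputable def twoLevelVec (q : ℕ) (a : ℝ) (i : Fin q) : Fin q → ℝ :=
  fun j => if j = i then a else (1 - a) / (q - 1)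

lemma twoLevelEnergy_betaC {q : ℕ} (hq : 3 ≤ q) (a : ℝ) :
    twoLevelEnergy q (betaC q) a =
      -(binEntropy a + q * log (q - 1) / (q - 2) * (a - 1 / 2) ^ 2) - log (q - 1)
        - log (q - 1) * (1 - q / 4) / (q - 2) := by
  have hQ : (3 : ℝ) ≤ q := by exact_mod_cast hq
  have h1 : (q : ℝ) - 1 ≠ 0 := by linarith
  have h2 : (q : ℝ) - 2 ≠ 0 := by linarith
  have h3 : (1 - a) * log ((1 - a) / (q - 1)) = (1 - a) * log (1 - a) - (1 - a) * log (q - 1) := by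
    rcases eq_or_ne (1 - a) 0 with h | h
    · simp [h]
    · rw [log_div h h1]
      ring
  rw [twoLevelEnergy, h3, betaC, binEntropy, log_inv, log_inv]
  field_simp
  ring

lemma twoLevelEnergy_betaC_lt {q : ℕ} (hq : 3 ≤ q) {a : ℝ} (ha : a ∈ Set.Icc (0 : ℝ) 1)
    (h1 : a ≠ (q : ℝ)⁻¹) (h2 : a ≠ ((q : ℝ) - 1) / q) :
    twoLevelEnergy q (betaC q) (q : ℝ)⁻¹ < twoLevelEnergy q (betaC q) a := by
  have hQ : (3 : ℝ) ≤ q := by exact_mod_cast hq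
  have h0 : (q : ℝ) ≠ 0 := by linarith
  have hq2 : (q : ℝ) - 2 ≠ 0 := by linarith
  have hp : 1 - (q : ℝ)⁻¹ = (q - 1) / q := by field_simp
  have := binEntropy_add_sq_lt (κ := q * log (q - 1) / (q - 2)) (p := ((q : ℝ) - 1) / q) (a := a)
    (by rw [div_lt_div_iff₀ (by norm_num) (by linarith)]; linarith)
    (by rw [div_lt_one (by linarith)]; linarith)
    (by rw [← hp, sub_sub_cancel, hp, log_div (by linarith) h0, log_inv]
        field_simp
        ring)
    ha h2 (by rw [← hp, sub_sub_cancel]; exact h1)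
  rw [← hp, binEntropy_one_sub] at this
  rw [twoLevelEnergy_betaC hq, twoLevelEnergy_betaC hq]
  have e : (1 - (q : ℝ)⁻¹ - 1 / 2) ^ 2 = ((q : ℝ)⁻¹ - 1 / 2) ^ 2 := by ring
  rw [e] at this
  linarith

lemma twoLevelEnergy_betaC_asym {q : ℕ} (hq : 3 ≤ q) :
    twoLevelEnergy q (betaC q) (((q : ℝ) - 1) / q) = twoLevelEnergy q (betaC q) (q : ℝ)⁻¹ := by
  have hQ : (3 : ℝ) ≤ q := by exact_mod_cast hq
  have hp : ((q : ℝ) - 1) / q = 1 - (q : ℝ)⁻¹ := by field_simp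
  rw [twoLevelEnergy_betaC hq, twoLevelEnergy_betaC hq, hp, binEntropy_one_sub]
  ring

/-- The site energy lies strictly above its tangent at the mean `m` of the remaining coordinates,
up to the largest coordinate `a`. -/
lemma betaC_sq_lt_mul_log {q : ℕ} (hq : 3 ≤ q) {a m t : ℝ} (ha : (q : ℝ)⁻¹ < a) (ha1 : a < 1)
    (hm : m = (1 - a) / (q - 1)) (ht0 : 0 ≤ t) (hta : t ≤ a) (htm : t ≠ m) :
    betaC q / 2 * (t - m) ^ 2 < t * log (t / m) - (t - m) := by
  have hQ : (3 : ℝ) ≤ q := by exact_mod_cast hq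
  have h0 : (0 : ℝ) < q := by linarith
  have h1 : (0 : ℝ) < q - 1 := by linarith
  have hm0 : 0 < m := by rw [hm]; exact div_pos (by linarith) h1
  have hsum : a + (q - 1) * m = 1 := by rw [hm]; field_simp; ring
  have hma : m < a := by
    rw [inv_lt_iff_one_lt_mul₀ h0] at ha
    nlinarith
  obtain ⟨R, rfl⟩ : ∃ R, a = R * m := ⟨a / m, by field_simp⟩
  obtain ⟨r, rfl⟩ : ∃ r, t = r * m := ⟨t / m, by field_simp⟩
  have hR : 1 < R := by nlinarith
  have hle : twoLevelEnergy q (betaC q) (q : ℝ)⁻¹ ≤ twoLevelEnergy q (betaC q) (R * m) := by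
    by_cases h : R * m = ((q : ℝ) - 1) / q
    · rw [h, twoLevelEnergy_betaC_asym hq]
    · exact (twoLevelEnergy_betaC_lt hq ⟨by positivity, ha1.le⟩ ha.ne' h).le
  have hminv : R + (q - 1) = m⁻¹ := by
    field_simp
    linarith
  have hcomp := mul_log_sub_mul_log_avg_lt h1 hR
  rw [hminv, sub_add_cancel, log_div (by positivity) h0.ne', log_inv] at hcomp
  have hu : twoLevelEnergy q (betaC q) (q : ℝ)⁻¹ = -log q - betaC q / 2 * (1 / q) := by
    have : (1 - (q : ℝ)⁻¹) / (q - 1) = (q : ℝ)⁻¹ := by field_simp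
    rw [twoLevelEnergy, this, log_inv]
    field_simp
    ring
  have hv : twoLevelEnergy q (betaC q) (R * m) =
      m * R * log R + log m - betaC q / 2 * (R ^ 2 + (q - 1)) * m ^ 2 := by
    rw [twoLevelEnergy, ← hm, log_mul (by linarith) hm0.ne',
      show 1 - R * m = (q - 1) * m by linarith]
    field_simp
    linear_combination (2 * log m) * hsum
  have hc : betaC q / 2 * m * (R - 1) ^ 2 < R * log R - R + 1 := by
    have hquad : (q : ℝ) * (m ^ 2 * (R ^ 2 + (q - 1)) - 1 / q) =
        (q - 1) * m ^ 2 * (R - 1) ^ 2 := by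
      field_simp
      linear_combination (R * m + (q - 1) * m + 1) * hsum
    have h2 : (q - 1) * (betaC q / 2 * m * (R - 1) ^ 2) ≤
        q * (R * log R - m⁻¹ * (-log m - log q)) := by
      rw [← mul_le_mul_iff_right₀ hm0]
      calc m * ((q - 1) * (betaC q / 2 * m * (R - 1) ^ 2))
          = betaC q / 2 * ((q - 1) * m ^ 2 * (R - 1) ^ 2) := by ring
        _ = q * (betaC q / 2 * (m ^ 2 * (R ^ 2 + (q - 1)) - 1 / q)) := by rw [← hquad]; ring
        _ ≤ q * (m * R * log R + log m + log q) := by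
            gcongr
            linarith
        _ = _ := by
            field_simp
            ring
    exact lt_of_mul_lt_mul_left (h2.trans_lt hcomp) h1.le
  have hr := sq_lt_mul_log hR hc (nonneg_of_mul_nonneg_left ht0 hm0)
    (le_of_mul_le_mul_right hta hm0) (fun h => htm (by rw [h, one_mul]))
  rw [mul_div_cancel_right₀ _ hm0.ne']
  nlinarith

/-- The excess of the free energy over its value when all coordinates but one are averaged. -/
lemma freeEnergy_eq_twoLevelEnergy_add {q : ℕ} [NeZero q] (hq : 3 ≤ q) {β m : ℝ}
    {x : Fin q → ℝ} (hx : ∑ i, x i = 1) (i : Fin q) (hm : m = (1 - x i) / (q - 1)) (hm0 : 0 < m) :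
    freeEnergy q β 0 x = twoLevelEnergy q β (x i) + ∑ j ∈ univ.erase i,
      (x j * log (x j / m) - (x j - m) - β / 2 * (x j - m) ^ 2) := by
  have hQ : (3 : ℝ) ≤ q := by exact_mod_cast hq
  have h1 : (q : ℝ) - 1 ≠ 0 := by linarith
  have hs : ∑ j ∈ univ.erase i, x j = (q - 1) * m := by
    rw [← add_sum_erase _ _ (mem_univ i)] at hx
    rw [hm]
    field_simp
    linarith
  have hcard : ((univ.erase i).card : ℝ) = q - 1 := by
    rw [card_erase_of_mem (mem_univ i), card_univ, Fintype.card_fin, Nat.cast_sub (by lia)]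
    simp
  have hterm : ∀ j ∈ univ.erase i, x j * log (x j / m) - (x j - m) - β / 2 * (x j - m) ^ 2 =
      x j * log (x j) - β / 2 * x j ^ 2 + (β * m - log m - 1) * x j + (m - β / 2 * m ^ 2) := by
    intro j _
    rcases eq_or_ne (x j) 0 with h | h
    · simp [h]
    · rw [log_div h hm0.ne']
      ring
  rw [sum_congr rfl hterm, sum_add_distrib, sum_add_distrib, sum_sub_distrib, ← mul_sum, ← mul_sum,
    sum_const, nsmul_eq_mul, hcard, hs, freeEnergy, ← add_sum_erase _ _ (mem_univ i),
    ← add_sum_erase univ (fun j => x j ^ 2) (mem_univ i), twoLevelEnergy, ← hm,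
    show 1 - x i = (q - 1) * m by rw [hm]; field_simp]
  field_simp
  ring

lemma twoLevelVec_mem_simplex {q : ℕ} (hq : 3 ≤ q) {a : ℝ} (ha : a ∈ Set.Icc (0 : ℝ) 1)
    (i : Fin q) : twoLevelVec q a i ∈ simplex q := by
  have hQ : (3 : ℝ) ≤ q := by exact_mod_cast hq
  have h1 : (q : ℝ) - 1 ≠ 0 := by linarith
  constructor
  · intro j
    unfold twoLevelVec
    split_ifs
    · exact ha.1
    · exact div_nonneg (by linarith [ha.2]) (by linarith)
  · have hoff : ∀ j ∈ univ.erase i, twoLevelVec q a i j = (1 - a) / ((q : ℝ) - 1) :=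
      fun j hj => if_neg (ne_of_mem_erase hj)
    rw [← add_sum_erase _ _ (mem_univ i), sum_congr rfl hoff, sum_const, nsmul_eq_mul,
      card_erase_of_mem (mem_univ i), card_univ, Fintype.card_fin, Nat.cast_sub (by lia)]
    simp only [twoLevelVec, if_true]
    push_cast
    field_simp
    ring

lemma freeEnergy_twoLevelVec {q : ℕ} [NeZero q] (hq : 3 ≤ q) {β a : ℝ} (ha : 0 ≤ a) (ha1 : a < 1)
    (i : Fin q) : freeEnergy q β 0 (twoLevelVec q a i) = twoLevelEnergy q β a := by
  have hQ : (3 : ℝ) ≤ q := by exact_mod_cast hq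
  have hm0 : 0 < (1 - a) / ((q : ℝ) - 1) := div_pos (by linarith) (by linarith)
  have hi : twoLevelVec q a i i = a := if_pos rfl
  rw [freeEnergy_eq_twoLevelEnergy_add hq (twoLevelVec_mem_simplex hq ⟨ha, ha1.le⟩ i).2 i
    (by rw [hi]) hm0, hi, add_eq_left]
  apply sum_eq_zero
  intro j hj
  rw [show twoLevelVec q a i j = (1 - a) / ((q : ℝ) - 1) from if_neg (ne_of_mem_erase hj),
    div_self hm0.ne']
  simp

lemma twoLevelVec_inv {q : ℕ} (hq : 3 ≤ q) (i : Fin q) :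
    twoLevelVec q (q : ℝ)⁻¹ i = fun _ => (q : ℝ)⁻¹ := by
  have hQ : (3 : ℝ) ≤ q := by exact_mod_cast hq
  have h1 : (q : ℝ) - 1 ≠ 0 := by linarith
  ext j
  simp only [twoLevelVec, ite_eq_left_iff]
  intro _
  field_simp

/-- Off the uniform vector and the asymmetric ones, the free energy exceeds its uniform value. -/
lemma freeEnergy_betaC_lt {q : ℕ} [NeZero q] (hq : 3 ≤ q) {x : Fin q → ℝ} (hx : x ∈ simplex q)
    (h1 : x ≠ fun _ => (q : ℝ)⁻¹) (h2 : ∀ i, x ≠ twoLevelVec q (((q : ℝ) - 1) / q) i) :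
    twoLevelEnergy q (betaC q) (q : ℝ)⁻¹ < freeEnergy q (betaC q) 0 x := by
  have hQ : (3 : ℝ) ≤ q := by exact_mod_cast hq
  have hq1 : (0 : ℝ) < q - 1 := by linarith
  obtain ⟨i, hi⟩ := Finite.exists_max x
  have ha : (q : ℝ)⁻¹ < x i := by
    by_contra! h
    apply h1
    have hle : ∀ j ∈ univ, x j ≤ (q : ℝ)⁻¹ := fun j _ => (hi j).trans h
    have := (sum_eq_sum_iff_of_le hle).1 (by
      rw [hx.2, sum_const, card_univ, Fintype.card_fin, nsmul_eq_mul, mul_inv_cancel₀ (by linarith)])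
    exact funext fun j => this j (mem_univ j)
  have hsum := hx.2
  rw [← add_sum_erase _ _ (mem_univ i)] at hsum
  have hnn : 0 ≤ ∑ j ∈ univ.erase i, x j := sum_nonneg fun j _ => hx.1 j
  have hvec : ∀ m, m = (1 - x i) / ((q : ℝ) - 1) → (∀ j ∈ univ.erase i, x j = m) →
      x = twoLevelVec q (x i) i := by
    rintro m rfl h
    ext j
    unfold twoLevelVec
    split_ifs with hj
    · rw [hj]
    · exact h j (mem_erase.2 ⟨hj, mem_univ j⟩)
  rcases eq_or_lt_of_le (show x i ≤ 1 by linarith) with h | hlt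
  · have hz : ∀ j ∈ univ.erase i, x j = 0 :=
      (sum_eq_zero_iff_of_nonneg fun j _ => hx.1 j).1 (by linarith)
    have hF : freeEnergy q (betaC q) 0 x = twoLevelEnergy q (betaC q) 1 := by
      rw [freeEnergy, ← add_sum_erase _ _ (mem_univ i),
        ← add_sum_erase univ (fun j => x j ^ 2) (mem_univ i),
        sum_eq_zero fun j hj => by rw [hz j hj, zero_mul],
        sum_eq_zero fun j hj => by rw [hz j hj, zero_pow two_ne_zero], h, twoLevelEnergy]
      simp
    rw [hF]
    apply twoLevelEnergy_betaC_lt hq ⟨zero_le_one, le_rfl⟩ (by rw [← h]; exact ha.ne')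
    rw [ne_comm, Ne, div_eq_one_iff_eq (by linarith)]
    linarith
  · have hm0 : 0 < (1 - x i) / ((q : ℝ) - 1) := div_pos (by linarith) hq1
    rw [freeEnergy_eq_twoLevelEnergy_add hq hx.2 i rfl hm0]
    have hterm : ∀ j, x j ≠ (1 - x i) / ((q : ℝ) - 1) →
        0 < x j * log (x j / ((1 - x i) / ((q : ℝ) - 1))) - (x j - (1 - x i) / ((q : ℝ) - 1))
          - betaC q / 2 * (x j - (1 - x i) / ((q : ℝ) - 1)) ^ 2 := fun j hj =>
      sub_pos.2 (betaC_sq_lt_mul_log hq ha hlt rfl (hx.1 j) (hi j) hj)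
    have hterm' : ∀ j,
        0 ≤ x j * log (x j / ((1 - x i) / ((q : ℝ) - 1))) - (x j - (1 - x i) / ((q : ℝ) - 1))
          - betaC q / 2 * (x j - (1 - x i) / ((q : ℝ) - 1)) ^ 2 := by
      intro j
      by_cases hj : x j = (1 - x i) / ((q : ℝ) - 1)
      · rw [hj, div_self hm0.ne']
        simp
      · exact (hterm j hj).le
    by_cases hc : x i = ((q : ℝ) - 1) / q
    · have hex : ∃ j ∈ univ.erase i, x j ≠ (1 - x i) / ((q : ℝ) - 1) := by
        by_contra! hall
        exact h2 i (by rw [← hc]; exact hvec _ rfl hall)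
      obtain ⟨j, hj, hne⟩ := hex
      have := sum_pos' (fun j _ => hterm' j) ⟨j, hj, hterm j hne⟩
      rw [← twoLevelEnergy_betaC_asym hq, ← hc]
      linarith
    · have := sum_nonneg (s := univ.erase i) fun j _ => hterm' j
      have := twoLevelEnergy_betaC_lt hq ⟨hx.1 i, hlt.le⟩ ha.ne' hc
      linarith

lemma xasym_comp {q : ℕ} [NeZero q] (hq : 3 ≤ q) (σ : Equiv.Perm (Fin q)) :
    xasym q ∘ σ = twoLevelVec q (((q : ℝ) - 1) / q) (σ.symm 0) := by
  have hQ : (3 : ℝ) ≤ q := by exact_mod_cast hq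
  have h1 : (q : ℝ) - 1 ≠ 0 := by linarith
  ext j
  simp only [Function.comp_apply, xasym, twoLevelVec, ← Equiv.eq_symm_apply]
  congr 1
  field_simp
  ring

lemma setOf_xasym_comp {q : ℕ} [NeZero q] (hq : 3 ≤ q) :
    {y | ∃ σ : Equiv.Perm (Fin q), y = xasym q ∘ σ} =
      Set.range (twoLevelVec q (((q : ℝ) - 1) / q)) := by
  ext y
  constructor
  · rintro ⟨σ, rfl⟩
    exact ⟨_, (xasym_comp hq σ).symm⟩
  · rintro ⟨i, rfl⟩
    exact ⟨Equiv.swap 0 i, by rw [xasym_comp hq, Equiv.symm_swap, Equiv.swap_apply_left]⟩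

lemma inv_lt_asym {q : ℕ} (hq : 3 ≤ q) : (q : ℝ)⁻¹ < ((q : ℝ) - 1) / q := by
  have hQ : (3 : ℝ) ≤ q := by exact_mod_cast hq
  rw [inv_eq_one_div]
  gcongr
  linarith

lemma twoLevelVec_apply_ne_asym {q : ℕ} (hq : 3 ≤ q) {i j : Fin q} (hj : j ≠ i) :
    twoLevelVec q (((q : ℝ) - 1) / q) i j ≠ ((q : ℝ) - 1) / q := by
  have hQ : (3 : ℝ) ≤ q := by exact_mod_cast hq
  have h1 : (0 : ℝ) < q - 1 := by linarith
  rw [twoLevelVec, if_neg hj]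
  apply ne_of_lt
  refine lt_trans ?_ (inv_lt_asym hq)
  rw [div_lt_iff₀ h1]
  have := inv_lt_asym hq
  rw [inv_mul_eq_div]
  have e : 1 - ((q : ℝ) - 1) / q = (q : ℝ)⁻¹ := by field_simp; ring
  rwa [e]

/-- for `q ≥ 3`, `h = 0`, `β = β_c`, there are exactly `q + 1` global
minimizers: the uniform vector together with the `q` permutations of
`((q−1)/q, 1/(q(q−1)), …, 1/(q(q−1)))`. -/
theorem stmt_9 (q : ℕ) [NeZero q] (hq : 3 ≤ q) :
    ({y | y ∈ simplex q ∧
        ∀ w ∈ simplex q, freeEnergy q (betaC q) 0 y ≤ freeEnergy q (betaC q) 0 w}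
      = insert (fun _ : Fin q => (q : ℝ)⁻¹)
          {y | ∃ σ : Equiv.Perm (Fin q), y = xasym q ∘ σ}) ∧
    Set.ncard {y | y ∈ simplex q ∧
        ∀ w ∈ simplex q, freeEnergy q (betaC q) 0 y ≤ freeEnergy q (betaC q) 0 w}
      = q + 1 := by
  have hQ : (3 : ℝ) ≤ q := by exact_mod_cast hq
  have hinv0 : (0 : ℝ) < (q : ℝ)⁻¹ := by positivity
  have hlt := inv_lt_asym hq
  have hasym1 : ((q : ℝ) - 1) / q < 1 := by
    rw [div_lt_one (by linarith)]
    linarith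
  have hunif : (fun _ : Fin q => (q : ℝ)⁻¹) ∈ simplex q := by
    rw [← twoLevelVec_inv hq 0]
    exact twoLevelVec_mem_simplex hq ⟨hinv0.le, by linarith⟩ 0
  have hFunif : freeEnergy q (betaC q) 0 (fun _ => (q : ℝ)⁻¹) =
      twoLevelEnergy q (betaC q) (q : ℝ)⁻¹ := by
    rw [← twoLevelVec_inv hq 0]
    exact freeEnergy_twoLevelVec hq hinv0.le (by linarith) 0
  have hFasym : ∀ i, freeEnergy q (betaC q) 0 (twoLevelVec q (((q : ℝ) - 1) / q) i) =
      twoLevelEnergy q (betaC q) (q : ℝ)⁻¹ := fun i => by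
    rw [freeEnergy_twoLevelVec hq (by linarith) hasym1, twoLevelEnergy_betaC_asym hq]
  have hmin : ∀ w ∈ simplex q, twoLevelEnergy q (betaC q) (q : ℝ)⁻¹ ≤
      freeEnergy q (betaC q) 0 w := by
    intro w hw
    by_cases h1 : w = fun _ => (q : ℝ)⁻¹
    · rw [h1, hFunif]
    by_cases h2 : ∃ i, w = twoLevelVec q (((q : ℝ) - 1) / q) i
    · obtain ⟨i, rfl⟩ := h2
      rw [hFasym]
    exact (freeEnergy_betaC_lt hq hw h1 (not_exists.1 h2)).le
  have hset : {y | y ∈ simplex q ∧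
        ∀ w ∈ simplex q, freeEnergy q (betaC q) 0 y ≤ freeEnergy q (betaC q) 0 w}
      = insert (fun _ : Fin q => (q : ℝ)⁻¹)
          {y | ∃ σ : Equiv.Perm (Fin q), y = xasym q ∘ σ} := by
    rw [setOf_xasym_comp hq]
    ext y
    constructor
    · rintro ⟨hy, hle⟩
      by_contra hn
      rw [Set.mem_insert_iff, not_or] at hn
      have := freeEnergy_betaC_lt hq hy hn.1 fun i h => hn.2 ⟨i, h.symm⟩
      exact (hle _ hunif).not_gt (hFunif ▸ this)
    · rintro (rfl | ⟨i, rfl⟩)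
      · exact ⟨hunif, fun w hw => hFunif.trans_le (hmin w hw)⟩
      · exact ⟨twoLevelVec_mem_simplex hq ⟨by linarith, hasym1.le⟩ i,
          fun w hw => (hFasym i).trans_le (hmin w hw)⟩
  refine ⟨hset, ?_⟩
  have hinj : Function.Injective (twoLevelVec q (((q : ℝ) - 1) / q)) := by
    intro i j hij
    by_contra hne
    exact twoLevelVec_apply_ne_asym hq hne (by rw [← hij]; exact if_pos rfl)
  rw [hset, setOf_xasym_comp hq, Set.ncard_insert_of_notMem, Set.ncard_range_of_injective hinj,
    Nat.card_fin]
  rintro ⟨i, hi⟩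
  have := congrFun hi i
  rw [twoLevelVec, if_pos rfl] at this
  linarith
end

section
/- Assume (β_n,h_n) → (β,h) with β, h ≥ 0 and (β,h) ≠ (β_0,h_0), and assume f_{β,h} has a unique global minimizer x = (x_1, x_q, …, x_q) in Ω (with last coordinate repeated q−1 times). For each n let d_n be an element of minimal Euclidean norm among d ∈ H such that x + d ∈ Ω is a local minimizer of f_{β_n,h_n} on Ω, and define the H-valued random variable W by N = n x + n d_n + n^{1/2} W, where N is distributed under μ_{β_n,h_n,n}. Then W converges in distribution to the centered Gaussian vector on H with covariance matrix K = (1/(x_1 x_q) − qβ)^{−1} M, where M_{11} = q−1, M_{1j} = M_{j1} = −1 for j ≥ 2, M_{jj} = 1 + (q−2)ρ for j ≥ 2, and M_{jk} = −ρ for distinct j,k ≥ 2, with ρ = (1/x_1 − β)/(1/x_q − β); the matrix K has rank q − 1. -/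
open Real Filter Finset Topology MeasureTheory

/-- Boltzmann weight of a spin configuration `σ : Fin n → Fin q`:
`exp((β/n) ∑_{i<j} δ_{σ_i,σ_j} + h ∑_i δ_{σ_i,1})`. -/
noncomputable def cwWeight (q n : ℕ) [NeZero q] (β h : ℝ) (σ : Fin n → Fin q) : ℝ :=
  Real.exp (β / n *
      ∑ p ∈ Finset.univ.filter (fun p : Fin n × Fin n => p.1 < p.2),
        (if σ p.1 = σ p.2 then (1 : ℝ) else 0)
    + h * ∑ i, (if σ i = 0 then (1 : ℝ) else 0))

/-- The partition function `Z_{β,h,n}`. -/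
noncomputable def cwZ (q n : ℕ) [NeZero q] (β h : ℝ) : ℝ :=
  ∑ σ : Fin n → Fin q, cwWeight q n β h σ

/-- The empirical color count `N_k(σ) = #{i : σ_i = k}`. -/
def colorCount {q n : ℕ} (σ : Fin n → Fin q) (k : Fin q) : ℕ :=
  (Finset.univ.filter (fun i => σ i = k)).card

/-- Probability of an event under the Curie–Weiss Potts measure `μ_{β,h,n}`. -/
noncomputable def cwProb (q n : ℕ) [NeZero q] (β h : ℝ) (A : Set (Fin n → Fin q)) : ℝ :=
  (∑ σ : Fin n → Fin q, Set.indicator A (cwWeight q n β h) σ) / cwZ q n β h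

/-- Expectation of an observable under the Curie–Weiss Potts measure `μ_{β,h,n}`. -/
noncomputable def cwExp (q n : ℕ) [NeZero q] (β h : ℝ) (g : (Fin n → Fin q) → ℝ) : ℝ :=
  (∑ σ : Fin n → Fin q, cwWeight q n β h σ * g σ) / cwZ q n β h

/-- `β_0 = 4(q−1)/q`. -/
noncomputable def beta0 (q : ℕ) : ℝ := 4 * ((q : ℝ) - 1) / q

/-- `h_0 = log(q−1) − 2(q−2)/q`. -/
noncomputable def h0 (q : ℕ) : ℝ := Real.log ((q : ℝ) - 1) - 2 * ((q : ℝ) - 2) / q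

/-- A probability measure on `ℝ^q` is the centered Gaussian with covariance matrix
`K` when each linear marginal `y ↦ ∑ a_i y_i` is the real Gaussian `N(0, aᵀKa)`. -/
def IsCenteredGaussianWithCov (q : ℕ) (K : Matrix (Fin q) (Fin q) ℝ)
    (ν : Measure (Fin q → ℝ)) : Prop :=
  IsProbabilityMeasure ν ∧
  ∀ a : Fin q → ℝ, ν.map (fun y => ∑ i, a i * y i)
    = ProbabilityTheory.gaussianReal 0 (Real.toNNReal (∑ i, ∑ j, a i * K i j * a j))

theorem exists_eigenbasis_sum_zero (q : ℕ) (D : Fin q → ℝ) :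
    ∃ (m : ℕ) (e : Fin m → Fin q → ℝ) (μ : Fin m → ℝ),
      (∀ k, ∑ i, e k i = 0) ∧
      (∀ k l, ∑ i, e k i * e l i = if k = l then 1 else 0) ∧
      (∀ w : Fin q → ℝ, ∑ i, w i = 0 → ∀ i, w i = ∑ k, (∑ j, e k j * w j) * e k i) ∧
      (∀ k, ∀ w : Fin q → ℝ, ∑ i, w i = 0 →
        ∑ i, D i * e k i * w i = μ k * ∑ i, e k i * w i) := by
  let H : Submodule ℝ (EuclideanSpace ℝ (Fin q)) := LinearMap.ker
    (∑ i, (EuclideanSpace.proj i : EuclideanSpace ℝ (Fin q) →L[ℝ] ℝ).toLinearMap)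
  have hH : ∀ w : EuclideanSpace ℝ (Fin q), w ∈ H ↔ ∑ i, w i = 0 := by
    intro w
    simp [H, LinearMap.mem_ker]
  let Dm : EuclideanSpace ℝ (Fin q) →ₗ[ℝ] EuclideanSpace ℝ (Fin q) :=
    Matrix.toEuclideanLin (Matrix.diagonal D)
  have hDm : ∀ (w : EuclideanSpace ℝ (Fin q)) i, Dm w i = D i * w i := by
    intro w i
    simp [Dm, Matrix.mulVec_diagonal]
  let T : H →ₗ[ℝ] H := H.orthogonalProjectionOnto.toLinearMap ∘ₗ Dm ∘ₗ H.subtype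
  have hTi : ∀ u v : H, inner ℝ (T u) v =
      ∑ i, D i * (u : EuclideanSpace ℝ (Fin q)) i * (v : EuclideanSpace ℝ (Fin q)) i := by
    intro u v
    simp only [T, LinearMap.comp_apply]
    have := Submodule.inner_orthogonalProjectionOnto_eq_of_mem_right v
      (Dm (u : EuclideanSpace ℝ (Fin q)))
    refine this.trans ?_
    simp [PiLp.inner_apply, hDm]
    refine Finset.sum_congr rfl fun i _ => by ring
  have hT : T.IsSymmetric := by
    intro u v
    rw [real_inner_comm (T v), hTi, hTi]
    refine Finset.sum_congr rfl fun i _ => by ring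
  let b := hT.eigenvectorBasis (rfl : Module.finrank ℝ H = Module.finrank ℝ H)
  have hin : ∀ u v : H, inner ℝ u v =
      ∑ i, (u : EuclideanSpace ℝ (Fin q)) i * (v : EuclideanSpace ℝ (Fin q)) i := by
    intro u v
    rw [Submodule.coe_inner]
    simp [PiLp.inner_apply]
    refine Finset.sum_congr rfl fun i _ => by ring
  refine ⟨_, fun k i => (b k : EuclideanSpace ℝ (Fin q)) i, hT.eigenvalues rfl, ?_, ?_, ?_, ?_⟩
  · intro k
    exact (hH _).1 (b k).2
  · intro k l
    rw [← hin]
    exact orthonormal_iff_ite.1 b.orthonormal k l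
  · intro w hw i
    let w' : H := ⟨WithLp.toLp 2 w, (hH _).2 hw⟩
    have h := b.sum_repr w'
    have h2 := congrArg (fun v : H => (v : EuclideanSpace ℝ (Fin q)) i) h
    simp only [b.repr_apply_apply, hin] at h2
    rw [show w i = (w' : EuclideanSpace ℝ (Fin q)) i from rfl, ← h2]
    simp [w']
  · intro k w hw
    let w' : H := ⟨WithLp.toLp 2 w, (hH _).2 hw⟩
    have h := hT.apply_eigenvectorBasis rfl k
    have h2 := hTi (b k) w'
    rw [show T (b k) = _ from h, inner_smul_left, hin] at h2
    simpa [w'] using h2.symm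

section DiagGaussian

variable {ι : Type*} [Fintype ι]

/-- The unnormalized density of a centered Gaussian with diagonal precision matrix `l`. -/
noncomputable def diagWeight (l : ι → ℝ) (u : ι → ℝ) : ℝ := Real.exp (-(∑ k, l k * u k ^ 2) / 2)

/-- The centered Gaussian with diagonal precision matrix `l`. -/
noncomputable def diagGaussian (l : ι → ℝ) : Measure (ι → ℝ) :=
  volume.withDensity fun u => ENNReal.ofReal (diagWeight l u / ∫ v, diagWeight l v)

theorem diagWeight_pos (l u : ι → ℝ) : 0 < diagWeight l u := Real.exp_pos _

theorem continuous_diagWeight (l : ι → ℝ) : Continuous (diagWeight l) := by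
  unfold diagWeight; fun_prop

theorem integrable_diagWeight {l : ι → ℝ} (hl : ∀ k, 0 < l k) :
    Integrable (diagWeight l) := by
  have h := (GaussianFourier.integrable_cexp_neg_sum_mul_add (b := fun k => ((l k / 2 : ℝ) : ℂ))
    (fun k => by simpa using hl k) (fun _ => 0)).norm
  refine h.congr (Eventually.of_forall fun u => ?_)
  simp only [Complex.norm_exp, diagWeight]
  congr 1
  norm_cast
  simp [Finset.sum_div, div_mul_eq_mul_div, neg_div]

theorem integral_diagWeight_pos {l : ι → ℝ} (hl : ∀ k, 0 < l k) :
    0 < ∫ v, diagWeight l v :=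
  integral_pos_of_integrable_nonneg_nonzero (x := 0) (continuous_diagWeight l)
    (integrable_diagWeight hl) (fun u => (diagWeight_pos l u).le) (diagWeight_pos l 0).ne'

theorem isProbabilityMeasure_diagGaussian {l : ι → ℝ} (hl : ∀ k, 0 < l k) :
    IsProbabilityMeasure (diagGaussian l) := by
  constructor
  rw [diagGaussian, withDensity_apply _ MeasurableSet.univ, Measure.restrict_univ,
    ← ofReal_integral_eq_lintegral_ofReal ((integrable_diagWeight hl).div_const _)
      (Eventually.of_forall fun u => div_nonneg (diagWeight_pos l u).le
        (integral_diagWeight_pos hl).le), integral_div, div_self (integral_diagWeight_pos hl).ne',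
    ENNReal.ofReal_one]

theorem integral_diagGaussian {E : Type*} [NormedAddCommGroup E] [NormedSpace ℝ E]
    (l : ι → ℝ) (F : (ι → ℝ) → E) :
    ∫ u, F u ∂(diagGaussian l) = (∫ v, diagWeight l v)⁻¹ • ∫ u, diagWeight l u • F u := by
  have hm : Measurable fun u => diagWeight l u / ∫ v, diagWeight l v :=
    ((continuous_diagWeight l).div_const _).measurable
  rw [diagGaussian, integral_withDensity_eq_integral_toReal_smul hm.ennreal_ofReal
    (Eventually.of_forall fun _ => ENNReal.ofReal_lt_top), ← integral_smul]
  refine integral_congr_ae (Eventually.of_forall fun u => ?_)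
  have : 0 ≤ diagWeight l u / ∫ v, diagWeight l v :=
    div_nonneg (diagWeight_pos l u).le (integral_nonneg fun v => (diagWeight_pos l v).le)
  simp only [ENNReal.toReal_ofReal this, smul_smul]
  rw [div_eq_inv_mul]

theorem integral_diagWeight_smul_cexp {l : ι → ℝ} (hl : ∀ k, 0 < l k) (c : ι → ℝ) :
    ∫ u, diagWeight l u • Complex.exp ((∑ k, c k * u k : ℝ) * Complex.I)
      = (∏ k, (π / ((l k / 2 : ℝ) : ℂ)) ^ (1 / 2 : ℂ)) *
        Complex.exp ((-(∑ k, c k ^ 2 / l k) / 2 : ℝ)) := by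
  have h := GaussianFourier.integral_cexp_neg_sum_mul_add (b := fun k => ((l k / 2 : ℝ) : ℂ))
    (fun k => by simpa using hl k) (fun k => c k * Complex.I)
  rw [Finset.prod_mul_distrib, ← Complex.exp_sum] at h
  convert h using 2
  · ext u
    rw [diagWeight, Complex.real_smul, Complex.ofReal_exp, ← Complex.exp_add]
    congr 1
    push_cast
    rw [neg_div, Finset.sum_div, Finset.sum_mul]
    congr 1
    · congr 1
      exact Finset.sum_congr rfl fun k _ => by ring
    · exact Finset.sum_congr rfl fun k _ => by ring
  · congr 1
    push_cast
    rw [neg_div, Finset.sum_div, ← Finset.sum_neg_distrib]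
    refine Finset.sum_congr rfl fun k _ => ?_
    have : (l k : ℂ) ≠ 0 := by exact_mod_cast (hl k).ne'
    rw [mul_pow, Complex.I_sq]
    field_simp
    norm_num

theorem integral_cexp_diagGaussian {l : ι → ℝ} (hl : ∀ k, 0 < l k) (c : ι → ℝ) :
    ∫ u, Complex.exp ((∑ k, c k * u k : ℝ) * Complex.I) ∂(diagGaussian l)
      = Complex.exp ((-(∑ k, c k ^ 2 / l k) / 2 : ℝ)) := by
  have h0 := integral_diagWeight_smul_cexp hl (fun _ => 0)
  have hZ := integral_diagWeight_pos hl
  simp only [zero_mul, Finset.sum_const_zero, Complex.ofReal_zero, Complex.exp_zero,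
    Complex.real_smul, mul_one, ne_eq, OfNat.ofNat_ne_zero, not_false_eq_true, zero_pow,
    zero_div, neg_zero, integral_complex_ofReal] at h0
  rw [integral_diagGaussian, integral_diagWeight_smul_cexp hl, ← h0, Complex.real_smul,
    Complex.ofReal_inv, inv_mul_cancel_left₀]
  exact_mod_cast hZ.ne'

theorem diagWeight_sub (l : ι → ℝ) (b : ℝ) (u : ι → ℝ) :
    diagWeight (fun k => l k - b) u = diagWeight l u * Real.exp (b / 2 * ∑ k, u k ^ 2) := by
  rw [diagWeight, diagWeight, ← Real.exp_add]
  congr 1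
  simp only [sub_mul, Finset.sum_sub_distrib, ← Finset.mul_sum]
  ring

/-- Tilting a diagonal Gaussian by a quadratic exponential lowers its precision. -/
theorem integral_diagGaussian_tilt {l : ι → ℝ} (hl : ∀ k, 0 < l k) {b : ℝ}
    (hb : ∀ k, 0 < l k - b) (F : (ι → ℝ) → ℝ) :
    ∫ u, F u ∂(diagGaussian fun k => l k - b) =
      (∫ u, Real.exp (b / 2 * ∑ k, u k ^ 2) * F u ∂(diagGaussian l)) /
        ∫ u, Real.exp (b / 2 * ∑ k, u k ^ 2) ∂(diagGaussian l) := by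
  have hZ := integral_diagWeight_pos hl
  have hZ' := integral_diagWeight_pos hb
  simp only [integral_diagGaussian, diagWeight_sub, smul_eq_mul, mul_assoc] at hZ' ⊢
  field_simp

theorem integrable_exp_diagGaussian {l : ι → ℝ} {b : ℝ}
    (hb : ∀ k, 0 < l k - b) :
    Integrable (fun u => Real.exp (b / 2 * ∑ k, u k ^ 2)) (diagGaussian l) := by
  have hm : Measurable fun u => diagWeight l u / ∫ v, diagWeight l v :=
    ((continuous_diagWeight l).div_const _).measurable
  rw [diagGaussian, integrable_withDensity_iff_integrable_smul' hm.ennreal_ofReal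
    (Eventually.of_forall fun _ => ENNReal.ofReal_lt_top)]
  refine ((integrable_diagWeight hb).const_mul (∫ v, diagWeight l v)⁻¹).congr
    (Eventually.of_forall fun u => ?_)
  have : 0 ≤ diagWeight l u / ∫ v, diagWeight l v :=
    div_nonneg (diagWeight_pos l u).le (integral_nonneg fun v => (diagWeight_pos l v).le)
  simp only [ENNReal.toReal_ofReal this, diagWeight_sub, smul_eq_mul]
  ring

end DiagGaussian

/-- Lévy's continuity theorem for finitely supported laws. -/
theorem tendsto_sum_of_tendsto_charFun {q : ℕ} {S : ℕ → Type*} [∀ n, Fintype (S n)]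
    (p : ∀ n, S n → ℝ) (Y : ∀ n, S n → Fin q → ℝ) (hp : ∀ n s, 0 ≤ p n s)
    (hp1 : ∀ n, ∑ s, p n s = 1) (γ : Measure (Fin q → ℝ)) [IsProbabilityMeasure γ]
    (h : ∀ a : Fin q → ℝ, Tendsto (fun n => ∑ s, (p n s : ℂ) *
        Complex.exp ((∑ i, a i * Y n s i : ℝ) * Complex.I)) atTop
      (𝓝 (∫ y, Complex.exp ((∑ i, a i * y i : ℝ) * Complex.I) ∂γ)))
    (g : (Fin q → ℝ) → ℝ) (hg : Continuous g) (C : ℝ) (hC : ∀ y, |g y| ≤ C) :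
    Tendsto (fun n => ∑ s, p n s * g (Y n s)) atTop (𝓝 (∫ y, g y ∂γ)) := by
  let μ : ∀ n, Measure (EuclideanSpace ℝ (Fin q)) := fun n =>
    ∑ s, ENNReal.ofReal (p n s) • Measure.dirac (WithLp.toLp 2 (Y n s))
  have hInt : ∀ {F : Type} [NormedAddCommGroup F] [NormedSpace ℝ F] [CompleteSpace F] (n)
      (f : EuclideanSpace ℝ (Fin q) → F), Continuous f →
      ∫ y, f y ∂(μ n) = ∑ s, p n s • f (WithLp.toLp 2 (Y n s)) := by
    intro F _ _ _ n f hf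
    rw [integral_finsetSum_measure]
    · refine Finset.sum_congr rfl fun s _ => ?_
      rw [integral_smul_measure, integral_dirac, ENNReal.toReal_ofReal (hp n s)]
    · intro s _
      exact (integrable_dirac (by simp)).smul_measure ENNReal.ofReal_ne_top
  have hμ : ∀ n, IsProbabilityMeasure (μ n) := by
    intro n
    constructor
    simp only [μ, Measure.coe_finsetSum, Measure.coe_smul, Finset.sum_apply, Pi.smul_apply,
      measure_univ, smul_eq_mul, mul_one]
    rw [← ENNReal.ofReal_sum_of_nonneg fun s _ => hp n s, hp1, ENNReal.ofReal_one]
  have hto : Continuous (WithLp.toLp 2 : (Fin q → ℝ) → EuclideanSpace ℝ (Fin q)) :=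
    PiLp.continuous_toLp 2 _
  let γ' : Measure (EuclideanSpace ℝ (Fin q)) := γ.map (WithLp.toLp 2)
  have hγ' : IsProbabilityMeasure γ' := Measure.isProbabilityMeasure_map hto.measurable.aemeasurable
  let μP : ℕ → ProbabilityMeasure (EuclideanSpace ℝ (Fin q)) := fun n => ⟨μ n, hμ n⟩
  let γP : ProbabilityMeasure (EuclideanSpace ℝ (Fin q)) := ⟨γ', hγ'⟩
  have key : Tendsto μP atTop (𝓝 γP) := by
    refine ProbabilityMeasure.tendsto_of_tendsto_charFun fun t => ?_
    have hc : Continuous fun y : EuclideanSpace ℝ (Fin q) =>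
        Complex.exp (((∑ i, t i * y i : ℝ) : ℂ) * Complex.I) := by fun_prop
    have hin : ∀ y : EuclideanSpace ℝ (Fin q), inner ℝ y t = ∑ i, t i * y i := by
      intro y
      simp [PiLp.inner_apply]
    simp only [charFun_apply, hin, ProbabilityMeasure.coe_mk, μP, γP]
    rw [integral_map hto.measurable.aemeasurable hc.aestronglyMeasurable]
    simp only [hInt _ _ hc, Complex.real_smul]
    exact h fun i => t i
  rw [ProbabilityMeasure.tendsto_iff_forall_integral_tendsto] at key
  have hcg : Continuous fun y : EuclideanSpace ℝ (Fin q) => g (WithLp.ofLp y) :=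
    hg.comp (PiLp.continuous_ofLp 2 _)
  have := key (BoundedContinuousFunction.ofNormedAddCommGroup
    (fun y => g (WithLp.ofLp y)) hcg C fun y => hC _)
  simp only [BoundedContinuousFunction.coe_ofNormedAddCommGroup, ProbabilityMeasure.coe_mk, μP,
    γP] at this
  rw [integral_map hto.measurable.aemeasurable hcg.aestronglyMeasurable] at this
  simpa only [hInt _ _ hcg, smul_eq_mul] using this

theorem abs_exp_sub_exp_le (s t : ℝ) :
    |Real.exp s - Real.exp t| ≤ |s - t| * Real.exp (max s t) := by
  wlog hst : t ≤ s generalizing s t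
  · rw [abs_sub_comm, abs_sub_comm s, max_comm]
    exact this t s (le_of_not_ge hst)
  rw [max_eq_left hst, abs_of_nonneg (sub_nonneg.2 (Real.exp_le_exp.2 hst)),
    abs_of_nonneg (sub_nonneg.2 hst)]
  have h := Real.add_one_le_exp (t - s)
  have h2 : Real.exp t = Real.exp s * Real.exp (t - s) := by rw [← Real.exp_add]; congr 1; ring
  rw [h2]
  nlinarith [Real.exp_pos s]

/-- Weak convergence passes to exponentially tilted laws under a uniform exponential moment. -/
theorem tendsto_sum_tilt {q : ℕ} {S : ℕ → Type*} [∀ n, Fintype (S n)]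
    (p : ∀ n, S n → ℝ) (Y : ∀ n, S n → Fin q → ℝ) (hp : ∀ n s, 0 ≤ p n s)
    (γ : Measure (Fin q → ℝ)) [IsProbabilityMeasure γ]
    (hweak : ∀ g : (Fin q → ℝ) → ℝ, Continuous g → ∀ C : ℝ, (∀ y, |g y| ≤ C) →
      Tendsto (fun n => ∑ s, p n s * g (Y n s)) atTop (𝓝 (∫ y, g y ∂γ)))
    {bs : ℕ → ℝ} {b c A : ℝ} (hbs : Tendsto bs atTop (𝓝 b)) (hbc : b < c)
    (hA : ∀ᶠ n in atTop, ∑ s, p n s * Real.exp (c / 2 * ∑ i, Y n s i ^ 2) ≤ A)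
    (hInt : Integrable (fun y : Fin q → ℝ => Real.exp (b / 2 * ∑ i, y i ^ 2)) γ)
    (g : (Fin q → ℝ) → ℝ) (hg : Continuous g) (M : ℝ) (hM : ∀ y, |g y| ≤ M) :
    Tendsto (fun n => ∑ s, p n s * (Real.exp (bs n / 2 * ∑ i, Y n s i ^ 2) * g (Y n s))) atTop
      (𝓝 (∫ y, Real.exp (b / 2 * ∑ i, y i ^ 2) * g y ∂γ)) := by
  have hM0 : 0 ≤ M := (abs_nonneg _).trans (hM 0)
  let N : (Fin q → ℝ) → ℝ := fun y => ∑ i, y i ^ 2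
  have hN0 : ∀ y, 0 ≤ N y := fun y => Finset.sum_nonneg fun i _ => sq_nonneg _
  have hNc : Continuous N := by fun_prop
  have hfix : Tendsto (fun n => ∑ s, p n s * (Real.exp (b / 2 * N (Y n s)) * g (Y n s))) atTop
      (𝓝 (∫ y, Real.exp (b / 2 * N y) * g y ∂γ)) := by
    let χ : ℕ → (Fin q → ℝ) → ℝ := fun R y => max 0 (min 1 (R + 1 - N y))
    have hχ0 : ∀ R y, 0 ≤ χ R y := fun R y => le_max_left _ _
    have hχ1 : ∀ R y, χ R y ≤ 1 := fun R y => max_le zero_le_one (min_le_left _ _)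
    have hχc : ∀ R, Continuous (χ R) := fun R => by fun_prop
    have hL : Tendsto (fun R => ∫ y, χ R y * (Real.exp (b / 2 * N y) * g y) ∂γ) atTop
        (𝓝 (∫ y, Real.exp (b / 2 * N y) * g y ∂γ)) := by
      refine tendsto_integral_of_dominated_convergence
        (fun y => M * Real.exp (b / 2 * N y)) (fun R => ?_) (hInt.const_mul M) (fun R => ?_) ?_
      · exact Continuous.aestronglyMeasurable (by fun_prop)
      · refine Eventually.of_forall fun y => ?_
        rw [Real.norm_eq_abs, abs_mul, abs_mul, abs_of_nonneg (hχ0 R y), Real.abs_exp]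
        calc χ R y * (Real.exp (b / 2 * N y) * |g y|)
            ≤ 1 * (Real.exp (b / 2 * N y) * M) := by
              gcongr
              exacts [hχ1 R y, hM y]
          _ = M * Real.exp (b / 2 * N y) := by ring
      · refine Eventually.of_forall fun y => tendsto_nhds_of_eventually_eq ?_
        obtain ⟨R0, hR0⟩ := exists_nat_ge (N y)
        filter_upwards [eventually_ge_atTop R0] with R hR
        have : (R0 : ℝ) ≤ R := by exact_mod_cast hR
        have : χ R y = 1 := by
          simp only [χ]
          rw [min_eq_left (by linarith), max_eq_right zero_le_one]
        rw [this, one_mul]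
    have hcut : ∀ R, Tendsto (fun n => ∑ s, p n s * (χ R (Y n s) *
        (Real.exp (b / 2 * N (Y n s)) * g (Y n s)))) atTop
        (𝓝 (∫ y, χ R y * (Real.exp (b / 2 * N y) * g y) ∂γ)) := by
      intro R
      refine hweak (fun y => χ R y * (Real.exp (b / 2 * N y) * g y)) (by fun_prop)
        (Real.exp (|b| / 2 * (R + 1)) * M) fun y => ?_
      rw [abs_mul, abs_mul, abs_of_nonneg (hχ0 R y), Real.abs_exp]
      by_cases hy : N y ≤ R + 1
      · calc χ R y * (Real.exp (b / 2 * N y) * |g y|)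
            ≤ 1 * (Real.exp (|b| / 2 * (R + 1)) * M) := by
              have hb := le_abs_self b
              have h0 := hN0 y
              gcongr
              exacts [hχ1 R y, hM y]
          _ = _ := one_mul _
      · have : χ R y = 0 := by
          simp only [χ]
          exact max_eq_left ((min_le_right _ _).trans (by linarith))
        rw [this, zero_mul]
        positivity
    have htail : ∀ᶠ n in atTop, ∀ R : ℕ,
        |∑ s, p n s * (Real.exp (b / 2 * N (Y n s)) * g (Y n s)) -
          ∑ s, p n s * (χ R (Y n s) * (Real.exp (b / 2 * N (Y n s)) * g (Y n s)))|
          ≤ M * A * Real.exp (-((c - b) / 2 * R)) := by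
      filter_upwards [hA] with n hn R
      rw [← Finset.sum_sub_distrib]
      refine (Finset.abs_sum_le_sum_abs _ _).trans ?_
      calc _ ≤ ∑ s, M * Real.exp (-((c - b) / 2 * R)) *
              (p n s * Real.exp (c / 2 * ∑ i, Y n s i ^ 2)) := by
            refine Finset.sum_le_sum fun s _ => ?_
            rw [← mul_sub, ← one_sub_mul, abs_mul, abs_mul, abs_mul, Real.abs_exp,
              abs_of_nonneg (hp n s), abs_of_nonneg (sub_nonneg.2 (hχ1 R _))]
            have hpt : (1 - χ R (Y n s)) * Real.exp (b / 2 * N (Y n s)) ≤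
                Real.exp (-((c - b) / 2 * R)) * Real.exp (c / 2 * N (Y n s)) := by
              by_cases hy : N (Y n s) ≤ R
              · have : χ R (Y n s) = 1 := by
                  simp only [χ]
                  rw [min_eq_left (by linarith), max_eq_right zero_le_one]
                rw [this, sub_self, zero_mul]
                positivity
              · rw [← Real.exp_add]
                calc _ ≤ 1 * Real.exp (b / 2 * N (Y n s)) := by
                      gcongr
                      linarith [hχ0 R (Y n s)]
                  _ ≤ _ := by
                      rw [one_mul]
                      gcongr
                      nlinarith
            calc
              _ = p n s * (((1 - χ R (Y n s)) * Real.exp (b / 2 * N (Y n s))) * |g (Y n s)|) := by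
                  ring
              _ ≤ p n s * ((Real.exp (-((c - b) / 2 * R)) * Real.exp (c / 2 * N (Y n s))) * M) := by
                  have := hp n s
                  gcongr
                  exact hM _
              _ = _ := by simp only [N]; ring
        _ ≤ _ := by
            rw [← Finset.mul_sum]
            calc _ ≤ M * Real.exp (-((c - b) / 2 * R)) * A := by gcongr
              _ = _ := by ring
    have htail0 : Tendsto (fun R : ℕ => M * A * Real.exp (-((c - b) / 2 * R))) atTop (𝓝 0) := by
      have h1 : Tendsto (fun R : ℕ => (c - b) / 2 * (R : ℝ)) atTop atTop :=
        tendsto_natCast_atTop_atTop.const_mul_atTop (by linarith)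
      simpa using (Real.tendsto_exp_neg_atTop_nhds_zero.comp h1).const_mul (M * A)
    rw [Metric.tendsto_nhds]
    intro ε hε
    have e1 := (Metric.tendsto_nhds.1 hL) (ε / 3) (by linarith)
    have e2 := (Metric.tendsto_nhds.1 htail0) (ε / 3) (by linarith)
    obtain ⟨R, h1, h2⟩ := (e1.and e2).exists
    filter_upwards [htail, (Metric.tendsto_nhds.1 (hcut R)) (ε / 3) (by linarith)] with n h3 h4
    have h3 := h3 R
    rw [Real.dist_eq] at h1 h2 h4 ⊢
    rw [sub_zero] at h2
    have h5 := (le_abs_self _).trans_lt h2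
    rw [abs_lt] at h1 h4 ⊢
    rw [abs_le] at h3
    constructor <;> linarith
  have hdiff : Tendsto (fun n => ∑ s, p n s * (Real.exp (bs n / 2 * N (Y n s)) * g (Y n s)) -
      ∑ s, p n s * (Real.exp (b / 2 * N (Y n s)) * g (Y n s))) atTop (𝓝 0) := by
    have hlt : ∀ᶠ n in atTop, bs n < (b + c) / 2 :=
      hbs.eventually_lt_const (by linarith)
    have hlim : Tendsto (fun n => |bs n - b| * (M * (2 / (c - b)) * A)) atTop (𝓝 0) := by
      have : Tendsto (fun n => |bs n - b|) atTop (𝓝 0) := by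
        simpa using (hbs.sub_const b).abs
      simpa using this.mul_const (M * (2 / (c - b)) * A)
    refine squeeze_zero_norm' ?_ hlim
    filter_upwards [hlt, hA] with n hn hnA
    rw [Real.norm_eq_abs, ← Finset.sum_sub_distrib]
    refine (Finset.abs_sum_le_sum_abs _ _).trans ?_
    have hcb : 0 < c - b := by linarith
    calc _ ≤ ∑ s, |bs n - b| * (M * (2 / (c - b))) *
            (p n s * Real.exp (c / 2 * ∑ i, Y n s i ^ 2)) := by
          refine Finset.sum_le_sum fun s _ => ?_
          rw [← mul_sub, ← sub_mul, abs_mul, abs_mul, abs_of_nonneg (hp n s)]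
          have hNs := hN0 (Y n s)
          have h1 := abs_exp_sub_exp_le (bs n / 2 * N (Y n s)) (b / 2 * N (Y n s))
          have h2 : max (bs n / 2 * N (Y n s)) (b / 2 * N (Y n s)) ≤ (b + c) / 4 * N (Y n s) :=
            max_le (by nlinarith) (by nlinarith)
          have h3 : |bs n / 2 * N (Y n s) - b / 2 * N (Y n s)| = |bs n - b| * (N (Y n s) / 2) := by
            rw [show bs n / 2 * N (Y n s) - b / 2 * N (Y n s) = (bs n - b) * (N (Y n s) / 2) by
              ring, abs_mul, abs_of_nonneg (show 0 ≤ N (Y n s) / 2 by positivity)]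
          have h4 : N (Y n s) / 2 ≤ 2 / (c - b) * Real.exp ((c - b) / 4 * N (Y n s)) := by
            have := Real.add_one_le_exp ((c - b) / 4 * N (Y n s))
            rw [div_mul_eq_mul_div, le_div_iff₀ hcb]
            nlinarith
          have h5 : |Real.exp (bs n / 2 * N (Y n s)) - Real.exp (b / 2 * N (Y n s))| ≤
              |bs n - b| * (2 / (c - b)) * Real.exp (c / 2 * N (Y n s)) := by
            refine h1.trans ?_
            rw [h3]
            calc _ ≤ |bs n - b| * (2 / (c - b) * Real.exp ((c - b) / 4 * N (Y n s))) *
                  Real.exp ((b + c) / 4 * N (Y n s)) := by gcongr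
              _ = |bs n - b| * (2 / (c - b)) * (Real.exp ((c - b) / 4 * N (Y n s)) *
                  Real.exp ((b + c) / 4 * N (Y n s))) := by ring
              _ = _ := by
                  rw [← Real.exp_add]
                  congr 2
                  ring
          calc _ ≤ p n s * (|bs n - b| * (2 / (c - b)) * Real.exp (c / 2 * N (Y n s)) * M) := by
                have := hp n s
                gcongr
                exact hM _
            _ = _ := by simp only [N]; ring
      _ ≤ _ := by
          rw [← Finset.mul_sum]
          calc _ ≤ |bs n - b| * (M * (2 / (c - b))) * A := by gcongr
            _ = _ := by ring
  simpa using hdiff.add hfix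

/-- The normalized deviation `(N - n z) / √n` of the color counts. -/
noncomputable def countDev {q n : ℕ} (z : Fin q → ℝ) (σ : Fin n → Fin q) (k : Fin q) : ℝ :=
  ((colorCount σ k : ℝ) - n * z k) / Real.sqrt n

theorem sum_colorCount_mul {q n : ℕ} (σ : Fin n → Fin q) (f : Fin q → ℝ) :
    ∑ k, (colorCount σ k : ℝ) * f k = ∑ i, f (σ i) := by
  have h : ∀ k, (colorCount σ k : ℝ) * f k = ∑ i, if σ i = k then f k else 0 := by
    intro k
    rw [← Finset.sum_filter, Finset.sum_const, nsmul_eq_mul]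
    rfl
  simp only [h]
  rw [Finset.sum_comm]
  exact Finset.sum_congr rfl fun i _ => by simp

theorem sum_mul_countDev {q n : ℕ} (z : Fin q → ℝ) (σ : Fin n → Fin q) (f : Fin q → ℝ) :
    ∑ k, f k * countDev z σ k = ∑ i, (f (σ i) - ∑ k, f k * z k) / Real.sqrt n := by
  have h := sum_colorCount_mul σ f
  rw [← Finset.sum_div, Finset.sum_sub_distrib, ← h]
  simp only [countDev, Finset.sum_const, Finset.card_univ, Fintype.card_fin, nsmul_eq_mul]
  rw [Finset.mul_sum, ← Finset.sum_sub_distrib, Finset.sum_div]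
  exact Finset.sum_congr rfl fun k _ => by ring

theorem sum_prod_mul_prod {q n : ℕ} {R : Type*} [CommSemiring R] (z f : Fin q → R) :
    ∑ σ : Fin n → Fin q, (∏ i, z (σ i)) * ∏ i, f (σ i) = (∑ k, z k * f k) ^ n := by
  rw [Fintype.sum_pow]
  exact Finset.sum_congr rfl fun σ _ => Finset.prod_mul_distrib.symm

theorem sum_prod_eq_one {q n : ℕ} {z : Fin q → ℝ} (hz : ∑ k, z k = 1) :
    ∑ σ : Fin n → Fin q, ∏ i, z (σ i) = 1 := by
  rw [← Fintype.sum_pow, hz, one_pow]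

theorem tendsto_mul_cexp_sub {τ : ℕ → ℝ} {t : ℝ} (hτ : Tendsto τ atTop (𝓝 t)) :
    Tendsto (fun n : ℕ => (n : ℂ) * (Complex.exp ((τ n / Real.sqrt n : ℝ) * Complex.I) - 1 -
      (τ n / Real.sqrt n : ℝ) * Complex.I)) atTop (𝓝 (-(t ^ 2 / 2 : ℝ))) := by
  have hs : Tendsto (fun n : ℕ => Real.sqrt n) atTop atTop :=
    Real.tendsto_sqrt_atTop.comp tendsto_natCast_atTop_atTop
  have hw : Tendsto (fun n : ℕ => τ n / Real.sqrt n) atTop (𝓝 0) := hτ.div_atTop hs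
  have h1 : Tendsto (fun n : ℕ => (-(τ n ^ 2 / 2 : ℝ) : ℂ)) atTop (𝓝 (-(t ^ 2 / 2 : ℝ))) :=
    ((Complex.continuous_ofReal.tendsto _).comp ((hτ.pow 2).div_const 2)).neg
  have h2 : Tendsto (fun n : ℕ => (n : ℂ) * (Complex.exp ((τ n / Real.sqrt n : ℝ) * Complex.I) - 1 -
      (τ n / Real.sqrt n : ℝ) * Complex.I) - (-(τ n ^ 2 / 2 : ℝ) : ℂ)) atTop (𝓝 0) := by
    have hb : Tendsto (fun n : ℕ => |τ n| ^ 2 * |τ n / Real.sqrt n|) atTop (𝓝 0) := by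
      simpa using (hτ.abs.pow 2).mul hw.abs
    refine squeeze_zero_norm' ?_ hb
    have hle : ∀ᶠ n : ℕ in atTop, |τ n / Real.sqrt n| < 1 := by
      have : Tendsto (fun n : ℕ => |τ n / Real.sqrt n|) atTop (𝓝 0) := by simpa using hw.abs
      exact this.eventually_lt_const one_pos
    filter_upwards [hle, eventually_gt_atTop 0] with n hn hn0
    have hn0' : (0 : ℝ) < n := by exact_mod_cast hn0
    have hsq : Real.sqrt n ^ 2 = n := Real.sq_sqrt hn0'.le
    have hsp : 0 < Real.sqrt n := Real.sqrt_pos.2 hn0'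
    set w : ℝ := τ n / Real.sqrt n with hwdef
    have hτw : τ n ^ 2 = n * w ^ 2 := by
      rw [hwdef, div_pow, hsq]
      field_simp
    have hnorm : ‖(w : ℂ) * Complex.I‖ = |w| := by simp
    have hbd := Complex.exp_bound (x := (w : ℂ) * Complex.I) (by rw [hnorm]; exact hn.le)
      (n := 3) (by norm_num)
    rw [hnorm] at hbd
    simp only [Finset.sum_range_succ, Finset.sum_range_zero, Nat.factorial] at hbd
    have heq : (n : ℂ) * (Complex.exp ((w : ℝ) * Complex.I) - 1 - (w : ℝ) * Complex.I) -
        (-(τ n ^ 2 / 2 : ℝ) : ℂ) = n * (Complex.exp ((w : ℂ) * Complex.I) -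
        (0 + ((w : ℂ) * Complex.I) ^ 0 / 1 + ((w : ℂ) * Complex.I) ^ 1 / 1 +
          ((w : ℂ) * Complex.I) ^ 2 / 2)) := by
      rw [hτw, mul_pow (w : ℂ) Complex.I 2, Complex.I_sq]
      push_cast
      ring
    rw [heq, norm_mul, Complex.norm_natCast]
    norm_num at hbd
    calc _ ≤ (n : ℝ) * (|w| ^ 3 * (2 / 9)) := by
          gcongr
          refine le_trans (le_of_eq ?_) hbd
          norm_num
      _ ≤ n * (|w| ^ 3 * 1) := by gcongr; norm_num
      _ = _ := by
          rw [sq_abs, hτw, ← sq_abs w]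
          ring
  simpa using h2.add h1

/-- Convergence of the characteristic functions of normalized multinomial counts. -/
theorem tendsto_charFun_countDev {q : ℕ} {z : ℕ → Fin q → ℝ} {x : Fin q → ℝ}
    (hz1 : ∀ n, ∑ k, z n k = 1) (hz : Tendsto z atTop (𝓝 x)) (a : Fin q → ℝ) :
    Tendsto (fun n : ℕ => ∑ σ : Fin n → Fin q, ((∏ i, z n (σ i) : ℝ) : ℂ) *
        Complex.exp ((∑ k, a k * countDev (z n) σ k : ℝ) * Complex.I)) atTop
      (𝓝 (Complex.exp ((-(∑ k, x k * (a k - ∑ j, a j * x j) ^ 2) / 2 : ℝ)))) := by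
  have hzk : ∀ k, Tendsto (fun n => z n k) atTop (𝓝 (x k)) := fun k =>
    ((continuous_apply k).tendsto x).comp hz
  let τ : Fin q → ℕ → ℝ := fun k n => a k - ∑ j, a j * z n j
  have hτ : ∀ k, Tendsto (τ k) atTop (𝓝 (a k - ∑ j, a j * x j)) := fun k =>
    tendsto_const_nhds.sub (tendsto_finsetSum _ fun j _ => (hzk j).const_mul _)
  have hτ0 : ∀ n, ∑ k, z n k * τ k n = 0 := by
    intro n
    simp only [τ, mul_sub, Finset.sum_sub_distrib, ← Finset.sum_mul, hz1]
    rw [one_mul, sub_eq_zero]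
    exact Finset.sum_congr rfl fun k _ => mul_comm _ _
  have hlim : Tendsto (fun n : ℕ => (n : ℂ) * ∑ k, (z n k : ℂ) *
      (Complex.exp ((τ k n / Real.sqrt n : ℝ) * Complex.I) - 1 -
      (τ k n / Real.sqrt n : ℝ) * Complex.I)) atTop
      (𝓝 ((-(∑ k, x k * (a k - ∑ j, a j * x j) ^ 2) / 2 : ℝ) : ℂ)) := by
    have : ((-(∑ k, x k * (a k - ∑ j, a j * x j) ^ 2) / 2 : ℝ) : ℂ) =
        ∑ k, (x k : ℂ) * (-((a k - ∑ j, a j * x j) ^ 2 / 2 : ℝ)) := by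
      push_cast
      rw [neg_div, Finset.sum_div, ← Finset.sum_neg_distrib]
      exact Finset.sum_congr rfl fun k _ => by ring
    rw [this]
    simp only [Finset.mul_sum]
    refine tendsto_finsetSum _ fun k _ => ?_
    refine (((Complex.continuous_ofReal.tendsto _).comp (hzk k)).mul
      (tendsto_mul_cexp_sub (hτ k))).congr fun n => ?_
    simp only [Function.comp_apply]
    ring
  refine (Complex.tendsto_one_add_pow_exp_of_tendsto hlim).congr fun n => ?_
  have hbase : 1 + ∑ k, (z n k : ℂ) * (Complex.exp ((τ k n / Real.sqrt n : ℝ) * Complex.I) - 1 -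
      (τ k n / Real.sqrt n : ℝ) * Complex.I) =
      ∑ k, (z n k : ℂ) * Complex.exp ((τ k n / Real.sqrt n : ℝ) * Complex.I) := by
    have h1 : ∑ k, (z n k : ℂ) = 1 := by exact_mod_cast hz1 n
    have h2 : ∑ k, (z n k : ℂ) * ((τ k n / Real.sqrt n : ℝ) * Complex.I) = 0 := by
      have : ∑ k, z n k * (τ k n / Real.sqrt n) = 0 := by
        simp only [← mul_div_assoc, ← Finset.sum_div, hτ0, zero_div]
      simp only [← mul_assoc, ← Finset.sum_mul]
      rw [show ∑ k, (z n k : ℂ) * (τ k n / Real.sqrt n : ℝ) = 0 by exact_mod_cast this, zero_mul]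
    simp only [mul_sub, Finset.sum_sub_distrib, mul_one, h1, h2]
    ring
  rw [hbase, ← sum_prod_mul_prod]
  refine Finset.sum_congr rfl fun σ _ => ?_
  rw [sum_mul_countDev, ← Complex.exp_sum]
  push_cast
  rw [Finset.sum_mul]
  simp only [τ]
  push_cast
  rfl

theorem integral_diagWeight_one_mul_exp {q : ℕ} (s : Fin q → ℝ) :
    ∫ u, diagWeight (fun _ => 1) u * Real.exp (∑ k, s k * u k) =
      Real.exp (1 / 2 * ∑ k, s k ^ 2) * ∫ u : Fin q → ℝ, diagWeight (fun _ => 1) u := by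
  rw [← integral_sub_right_eq_self (fun u => diagWeight (fun _ => 1) u) s, ← integral_const_mul]
  refine integral_congr_ae (Eventually.of_forall fun u => ?_)
  simp only [diagWeight, ← Real.exp_add]
  congr 1
  rw [neg_div, neg_div, Finset.mul_sum, Finset.sum_div, Finset.sum_div,
    ← Finset.sum_neg_distrib, ← Finset.sum_neg_distrib, ← Finset.sum_add_distrib,
    ← Finset.sum_add_distrib]
  exact Finset.sum_congr rfl fun k _ => by simp only [Pi.sub_apply]; ring

theorem integrable_diagWeight_one_mul_exp {q : ℕ} (s : Fin q → ℝ) :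
    Integrable fun u => diagWeight (fun _ => 1) u * Real.exp (∑ k, s k * u k) := by
  refine (((integrable_diagWeight (l := fun _ : Fin q => (1 : ℝ)) fun _ => one_pos).comp_sub_right
    s).const_mul (Real.exp (1 / 2 * ∑ k, s k ^ 2))).congr (Eventually.of_forall fun u => ?_)
  simp only [diagWeight, ← Real.exp_add]
  congr 1
  rw [neg_div, neg_div, Finset.mul_sum, Finset.sum_div, Finset.sum_div,
    ← Finset.sum_neg_distrib, ← Finset.sum_neg_distrib, ← Finset.sum_add_distrib,
    ← Finset.sum_add_distrib]
  exact Finset.sum_congr rfl fun k _ => by simp only [Pi.sub_apply]; ring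

/-- A sub-Gaussian bound on the log-Laplace transform of `z` gives a quadratic exponential moment
of the normalized multinomial counts which is uniform in `n`. -/
theorem sum_prod_mul_exp_sq_countDev_le {q n : ℕ} (hn : n ≠ 0) {z : Fin q → ℝ}
    (hz : ∀ k, 0 ≤ z k) {b c : ℝ} (hb : 0 ≤ b) (hbc : b < c)
    (hL : ∀ u : Fin q → ℝ, ∑ k, z k * Real.exp (u k) ≤
      Real.exp (∑ k, u k * z k + (∑ k, u k ^ 2) / (2 * c))) :
    ∑ σ : Fin n → Fin q, (∏ i, z (σ i)) * Real.exp (b / 2 * ∑ k, countDev z σ k ^ 2) ≤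
      (∫ u, diagWeight (fun _ : Fin q => 1 - b / c) u) /
        ∫ u, diagWeight (fun _ : Fin q => 1) u := by
  have hc : 0 < c := hb.trans_lt hbc
  have hn' : (0 : ℝ) < n := by positivity
  have hsn : 0 < Real.sqrt n := Real.sqrt_pos.2 hn'
  have hZ : 0 < ∫ u, diagWeight (fun _ : Fin q => 1) u := integral_diagWeight_pos fun _ => one_pos
  have hbc1 : 0 < 1 - b / c := by
    rw [sub_pos, div_lt_one hc]; exact hbc
  have hpt : ∀ u : Fin q → ℝ, ∑ σ : Fin n → Fin q, (∏ i, z (σ i)) *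
      Real.exp (∑ k, (Real.sqrt b * countDev z σ k) * u k) ≤
      Real.exp (b / c / 2 * ∑ k, u k ^ 2) := by
    intro u
    let v : Fin q → ℝ := fun k => Real.sqrt b / Real.sqrt n * u k
    have h1 : ∀ σ : Fin n → Fin q, Real.exp (∑ k, (Real.sqrt b * countDev z σ k) * u k) =
        ∏ i, Real.exp (v (σ i) - ∑ k, v k * z k) := by
      intro σ
      rw [← Real.exp_sum]
      congr 1
      have := sum_mul_countDev z σ fun k => Real.sqrt b * u k
      calc _ = ∑ k, Real.sqrt b * u k * countDev z σ k :=
            Finset.sum_congr rfl fun k _ => by ring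
        _ = _ := by
            rw [this]
            refine Finset.sum_congr rfl fun i _ => ?_
            rw [sub_div, Finset.sum_div]
            congr 1
            · simp only [v]; ring
            · exact Finset.sum_congr rfl fun k _ => by simp only [v]; ring
    simp only [h1]
    rw [sum_prod_mul_prod z fun k => Real.exp (v k - ∑ j, v j * z j)]
    have h2 : ∑ k, z k * Real.exp (v k - ∑ j, v j * z j) ≤
        Real.exp ((∑ k, v k ^ 2) / (2 * c)) := by
      simp only [Real.exp_sub, ← mul_div_assoc, ← Finset.sum_div]
      rw [div_le_iff₀ (Real.exp_pos _), ← Real.exp_add, add_comm]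
      exact hL v
    calc _ ≤ Real.exp ((∑ k, v k ^ 2) / (2 * c)) ^ n := by
          refine pow_le_pow_left₀ (Finset.sum_nonneg fun k _ => ?_) h2 n
          exact mul_nonneg (hz k) (Real.exp_pos _).le
      _ = _ := by
          rw [← Real.exp_nat_mul]
          congr 1
          simp only [v, mul_pow, div_pow, Real.sq_sqrt hb, Real.sq_sqrt hn'.le, ← Finset.mul_sum]
          field_simp
  rw [le_div_iff₀ hZ, Finset.sum_mul]
  calc _ = ∑ σ : Fin n → Fin q, ∫ u, (∏ i, z (σ i)) * (diagWeight (fun _ => 1) u *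
          Real.exp (∑ k, (Real.sqrt b * countDev z σ k) * u k)) := by
        refine Finset.sum_congr rfl fun σ _ => ?_
        rw [integral_const_mul, integral_diagWeight_one_mul_exp, mul_assoc]
        simp only [mul_pow, Real.sq_sqrt hb, ← Finset.mul_sum]
        congr 3
        ring
    _ = ∫ u, ∑ σ : Fin n → Fin q, (∏ i, z (σ i)) * (diagWeight (fun _ => 1) u *
          Real.exp (∑ k, (Real.sqrt b * countDev z σ k) * u k)) :=
        (integral_finsetSum _ fun σ _ =>
          (integrable_diagWeight_one_mul_exp _).const_mul _).symm
    _ ≤ _ := by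
        refine integral_mono (integrable_finsetSum _ fun σ _ =>
          (integrable_diagWeight_one_mul_exp _).const_mul _)
          (integrable_diagWeight fun _ => hbc1) fun u => ?_
        simp only [diagWeight_sub]
        calc _ = diagWeight (fun _ => 1) u * ∑ σ : Fin n → Fin q, (∏ i, z (σ i)) *
              Real.exp (∑ k, (Real.sqrt b * countDev z σ k) * u k) := by
              rw [Finset.mul_sum]
              exact Finset.sum_congr rfl fun σ _ => by ring
          _ ≤ _ := by
              gcongr
              exacts [(diagWeight_pos _ _).le, hpt u]

/-- A centered Gaussian on the hyperplane `∑ i, w i = 0` with precision form `∑ i, D i * w i ^ 2`,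
together with its tilt by `exp (b / 2 * ‖y‖ ^ 2)`. The maps `C₀` and `C` are the covariances. -/
theorem exists_gaussian_and_tilt (q : ℕ) (D : Fin q → ℝ) {b : ℝ} (hb : 0 ≤ b)
    (hpos : ∀ w : Fin q → ℝ, w ≠ 0 → ∑ i, w i = 0 → 0 < ∑ i, (D i - b) * w i ^ 2)
    (C₀ C : (Fin q → ℝ) → Fin q → ℝ)
    (hC₀ : ∀ a, ∑ i, C₀ a i = 0) (hC : ∀ a, ∑ i, C a i = 0)
    (hDC₀ : ∀ a w : Fin q → ℝ, ∑ i, w i = 0 → ∑ i, D i * C₀ a i * w i = ∑ i, a i * w i)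
    (hDC : ∀ a w : Fin q → ℝ, ∑ i, w i = 0 → ∑ i, (D i - b) * C a i * w i = ∑ i, a i * w i) :
    ∃ γ ν : Measure (Fin q → ℝ), IsProbabilityMeasure γ ∧ IsProbabilityMeasure ν ∧
      (∀ a : Fin q → ℝ, ∫ y, Complex.exp ((∑ i, a i * y i : ℝ) * Complex.I) ∂γ =
        Complex.exp ((-(∑ i, a i * C₀ a i) / 2 : ℝ))) ∧
      Integrable (fun y : Fin q → ℝ => Real.exp (b / 2 * ∑ i, y i ^ 2)) γ ∧
      (∀ g : (Fin q → ℝ) → ℝ, Continuous g → ∫ y, g y ∂ν =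
        (∫ y, Real.exp (b / 2 * ∑ i, y i ^ 2) * g y ∂γ) /
          ∫ y, Real.exp (b / 2 * ∑ i, y i ^ 2) ∂γ) ∧
      ∀ a : Fin q → ℝ, ν.map (fun y => ∑ i, a i * y i) =
        ProbabilityTheory.gaussianReal 0 (Real.toNNReal (∑ i, a i * C a i)) := by
  obtain ⟨m, e, μ, he0, heo, hespan, heig⟩ := exists_eigenbasis_sum_zero q D
  have hene : ∀ k, e k ≠ 0 := by
    intro k hk
    have := heo k k
    simp [hk] at this
  have hμb : ∀ k, 0 < μ k - b := by
    intro k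
    have h := hpos (e k) (hene k) (he0 k)
    have h1 := heig k (e k) (he0 k)
    have h2 := heo k k
    rw [if_pos rfl] at h2
    rw [h2, mul_one] at h1
    calc 0 < ∑ i, (D i - b) * e k i ^ 2 := h
      _ = ∑ i, D i * e k i * e k i - b * ∑ i, e k i * e k i := by
          rw [Finset.mul_sum, ← Finset.sum_sub_distrib]
          exact Finset.sum_congr rfl fun i _ => by ring
      _ = μ k - b := by rw [h1, h2, mul_one]
  have hμ : ∀ k, 0 < μ k := fun k => by linarith [hμb k]
  have hquad : ∀ (s : ℝ) (a v : Fin q → ℝ), (∀ k, 0 < μ k - s) → ∑ i, v i = 0 →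
      (∀ w : Fin q → ℝ, ∑ i, w i = 0 → ∑ i, (D i - s) * v i * w i = ∑ i, a i * w i) →
      ∑ k, (∑ i, a i * e k i) ^ 2 / (μ k - s) = ∑ i, a i * v i := by
    intro s a v hs hv hav
    have h1 : ∀ k, ∑ j, e k j * v j = (∑ i, a i * e k i) / (μ k - s) := by
      intro k
      rw [eq_div_iff (hs k).ne', ← hav (e k) (he0 k)]
      calc _ = μ k * ∑ j, e k j * v j - s * ∑ j, e k j * v j := by ring
        _ = _ := by
            rw [← heig k v hv, Finset.mul_sum, ← Finset.sum_sub_distrib]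
            exact Finset.sum_congr rfl fun i _ => by ring
    calc _ = ∑ k, (∑ i, a i * e k i) * ∑ j, e k j * v j :=
          Finset.sum_congr rfl fun k _ => by rw [h1]; ring
      _ = ∑ i, a i * ∑ k, (∑ j, e k j * v j) * e k i := by
          have h2 : ∀ k, (∑ i, a i * e k i) * ∑ j, e k j * v j =
              ∑ i, a i * ((∑ j, e k j * v j) * e k i) := fun k => by
            rw [Finset.sum_mul (f := fun i => a i * e k i)]
            exact Finset.sum_congr rfl fun i _ => by ring
          have h3 : ∀ i, a i * ∑ k, (∑ j, e k j * v j) * e k i =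
              ∑ k, a i * ((∑ j, e k j * v j) * e k i) := fun i => Finset.mul_sum _ _ _
          simp only [h2, h3]
          exact Finset.sum_comm
      _ = _ := Finset.sum_congr rfl fun i _ => by rw [← hespan v hv i]
  let L : (Fin m → ℝ) → Fin q → ℝ := fun u i => ∑ k, u k * e k i
  have hLc : Continuous L := by fun_prop
  have hLa : ∀ (a : Fin q → ℝ) u, ∑ i, a i * L u i = ∑ k, (∑ i, a i * e k i) * u k := by
    intro a u
    simp only [L, Finset.mul_sum, Finset.sum_mul]
    rw [Finset.sum_comm]
    refine Finset.sum_congr rfl fun k _ => Finset.sum_congr rfl fun i _ => by ring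
  have hLsq : ∀ u, ∑ i, L u i ^ 2 = ∑ k, u k ^ 2 := by
    intro u
    have h1 : ∀ k, ∑ i, L u i * e k i = u k := by
      intro k
      simp only [L, Finset.sum_mul]
      rw [Finset.sum_comm]
      simp only [mul_assoc, ← Finset.mul_sum, heo]
      simp
    simp only [sq]
    rw [hLa (L u) u]
    exact Finset.sum_congr rfl fun k _ => by rw [h1]
  have hPγ := isProbabilityMeasure_diagGaussian hμ
  have hPν := isProbabilityMeasure_diagGaussian hμb
  have hLm := hLc.measurable.aemeasurable (μ := diagGaussian μ)
  have hLm' := hLc.measurable.aemeasurable (μ := diagGaussian fun k => μ k - b)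
  refine ⟨(diagGaussian μ).map L, (diagGaussian fun k => μ k - b).map L,
    Measure.isProbabilityMeasure_map hLm, Measure.isProbabilityMeasure_map hLm', ?_, ?_, ?_, ?_⟩
  · intro a
    rw [integral_map hLm (Continuous.aestronglyMeasurable (by fun_prop))]
    simp only [hLa]
    rw [integral_cexp_diagGaussian hμ]
    have := hquad 0 a (C₀ a) (by simpa using hμ) (hC₀ a) (by simpa using hDC₀ a)
    simp only [sub_zero] at this
    rw [this]
  · rw [integrable_map_measure (Continuous.aestronglyMeasurable (by fun_prop)) hLm]
    refine (integrable_exp_diagGaussian hμb).congr (Eventually.of_forall fun u => ?_)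
    simp only [Function.comp_apply, hLsq]
  · intro g hg
    rw [integral_map hLm' hg.aestronglyMeasurable,
      integral_map hLm (Continuous.aestronglyMeasurable (by fun_prop)),
      integral_map hLm (Continuous.aestronglyMeasurable (by fun_prop))]
    simp only [hLsq]
    exact integral_diagGaussian_tilt hμ hμb _
  · intro a
    have hac : Continuous fun y : Fin q → ℝ => ∑ i, a i * y i := by fun_prop
    rw [Measure.map_map hac.measurable hLc.measurable]
    have hm : AEMeasurable ((fun y : Fin q → ℝ => ∑ i, a i * y i) ∘ L)
        (diagGaussian fun k => μ k - b) := (hac.comp hLc).measurable.aemeasurable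
    have := Measure.isProbabilityMeasure_map hm
    refine Measure.ext_of_charFun (funext fun t => ?_)
    rw [ProbabilityTheory.charFun_gaussianReal, charFun_apply_real,
      integral_map hm (Continuous.aestronglyMeasurable (by fun_prop))]
    have hq := hquad b a (C a) hμb (hC a) (hDC a)
    have hnn : 0 ≤ ∑ i, a i * C a i := by
      rw [← hq]
      exact Finset.sum_nonneg fun k _ => div_nonneg (sq_nonneg _) (hμb k).le
    have h1 := integral_cexp_diagGaussian hμb fun k => t * ∑ i, a i * e k i
    have h2 : ∀ u, (((∑ k, (t * ∑ i, a i * e k i) * u k : ℝ) : ℂ)) =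
        t * ((((fun y : Fin q → ℝ => ∑ i, a i * y i) ∘ L) u : ℝ) : ℂ) := by
      intro u
      rw [Function.comp_apply, hLa, ← Complex.ofReal_mul, Finset.mul_sum]
      congr 1
      exact Finset.sum_congr rfl fun k _ => by ring
    simp only [h2] at h1
    rw [h1]
    congr 1
    rw [Real.coe_toNNReal _ hnn, ← hq]
    push_cast
    rw [mul_zero, zero_mul, zero_sub, Finset.sum_mul, neg_div]
    congr 2
    exact Finset.sum_congr rfl fun k _ => by ring

theorem not_eventually_le_mul_log_add {R : ℝ → ℝ} (hR : DifferentiableAt ℝ R 0) :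
    ¬ ∀ᶠ t in 𝓝[>] (0 : ℝ), R 0 ≤ t * Real.log t + R t := by
  intro h
  have h1 : Tendsto (fun t => Real.log t + slope R 0 t) (𝓝[>] 0) atBot :=
    Real.tendsto_log_nhdsGT_zero.atBot_add
      (hR.hasDerivAt.tendsto_slope.mono_left (nhdsWithin_mono _ fun t (ht : 0 < t) => ht.ne'))
  obtain ⟨t, h2, h3, ht⟩ := (h.and ((h1.eventually_lt_atBot 0).and self_mem_nhdsWithin)).exists
  have ht : 0 < t := ht
  rw [slope_def_field, sub_zero] at h3
  have h4 : t * (Real.log t + (R t - R 0) / t) < 0 := mul_neg_of_pos_of_neg ht h3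
  rw [mul_add, mul_div_cancel₀ _ ht.ne'] at h4
  linarith

theorem add_smul_mem_simplex {q : ℕ} {z v : Fin q → ℝ} (hz : z ∈ simplex q) (hv : ∑ i, v i = 0)
    {t : ℝ} (h : ∀ i, 0 ≤ z i + t * v i) : z + t • v ∈ simplex q := by
  refine ⟨fun i => by simpa using h i, ?_⟩
  simp [Finset.sum_add_distrib, ← Finset.mul_sum, hv, hz.2]

theorem IsLocalMinOn.simplex_pos {q : ℕ} [NeZero q] {β h : ℝ} {z : Fin q → ℝ} (hz : z ∈ simplex q)
    (hmin : IsLocalMinOn (freeEnergy q β h) (simplex q) z) (i : Fin q) : 0 < z i := by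
  refine (hz.1 i).lt_of_ne' fun hi => ?_
  obtain ⟨j, hj⟩ : ∃ j, 0 < z j := by
    by_contra! hc
    have := Finset.sum_nonpos fun k (_ : k ∈ Finset.univ) => hc k
    linarith [hz.2]
  have hij : j ≠ i := fun hc => by rw [hc, hi] at hj; exact lt_irrefl _ hj
  let v : Fin q → ℝ := fun k => (if k = i then 1 else 0) - if k = j then 1 else 0
  have hvi : v i = 1 := by simp [v, hij.symm]
  have hvj : v j = -1 := by simp [v, hij]
  have hvk : ∀ k, k ≠ i → k ≠ j → v k = 0 := fun k h1 h2 => by simp [v, h1, h2]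
  have hv : ∑ k, v k = 0 := by simp [v]
  let R : ℝ → ℝ := fun t => ∑ k ∈ Finset.univ.erase i, (z k + t * v k) * Real.log (z k + t * v k) -
    β / 2 * ∑ k, (z k + t * v k) ^ 2 - h * (z 0 + t * v 0)
  have hf : ∀ t, freeEnergy q β h (z + t • v) = t * Real.log t + R t := by
    intro t
    simp only [freeEnergy, R, Pi.add_apply, Pi.smul_apply, smul_eq_mul]
    rw [← Finset.add_sum_erase _ _ (Finset.mem_univ i), hi, hvi, zero_add, mul_one]
    ring
  have hR : DifferentiableAt ℝ R 0 := by
    have h1 : ∀ k ∈ Finset.univ.erase i,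
        DifferentiableAt ℝ (fun t => (z k + t * v k) * Real.log (z k + t * v k)) 0 := by
      intro k hk
      by_cases hkj : k = j
      · have : z k + 0 * v k ≠ 0 := by rw [hkj]; simpa using hj.ne'
        fun_prop (disch := exact this)
      · simp [hvk k (Finset.ne_of_mem_erase hk) hkj]
    have h2 := DifferentiableAt.fun_sum h1
    fun_prop
  refine not_eventually_le_mul_log_add hR ?_
  have hc : Tendsto (fun t : ℝ => z + t • v) (𝓝[>] 0) (𝓝[simplex q] z) := by
    refine tendsto_nhdsWithin_iff.2 ⟨?_, ?_⟩
    · have : Continuous fun t : ℝ => z + t • v := by fun_prop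
      simpa using (this.tendsto 0).mono_left nhdsWithin_le_nhds
    · filter_upwards [Ioo_mem_nhdsGT hj] with t ht
      refine add_smul_mem_simplex hz hv fun k => ?_
      by_cases h1 : k = i
      · rw [h1, hvi, hi]; linarith [ht.1]
      by_cases h2 : k = j
      · rw [h2, hvj]; linarith [ht.2]
      · rw [hvk k h1 h2]; simpa using hz.1 k
  filter_upwards [hc.eventually hmin] with t ht
  have h0 := hf 0
  rw [zero_smul, add_zero] at h0
  rw [← hf t]
  simpa [h0] using ht

theorem hasDerivAt_freeEnergy_line {q : ℕ} [NeZero q] {β h t : ℝ} {z v : Fin q → ℝ}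
    (hz : ∀ i, z i + t * v i ≠ 0) :
    HasDerivAt (fun s : ℝ => freeEnergy q β h (z + s • v))
      (∑ i, v i * (Real.log (z i + t * v i) + 1 - β * (z i + t * v i)) - h * v 0) t := by
  have hl : ∀ i, HasDerivAt (fun s : ℝ => z i + s * v i) (v i) t := fun i => by
    simpa using ((hasDerivAt_id t).mul_const (v i)).const_add (z i)
  have h1 : HasDerivAt (fun s : ℝ => ∑ i, (z i + s * v i) * Real.log (z i + s * v i))
      (∑ i, (v i * Real.log (z i + t * v i) + (z i + t * v i) * (v i / (z i + t * v i)))) t :=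
    HasDerivAt.fun_sum fun i _ => (hl i).mul ((hl i).log (hz i))
  have h2 : HasDerivAt (fun s : ℝ => ∑ i, (z i + s * v i) ^ 2)
      (∑ i, 2 * (z i + t * v i) * v i) t :=
    HasDerivAt.fun_sum fun i _ => by simpa using (hl i).fun_pow 2
  have h3 := (h1.sub (h2.const_mul (β / 2))).sub ((hl 0).const_mul h)
  simp only [freeEnergy, Pi.add_apply, Pi.smul_apply, smul_eq_mul]
  refine h3.congr_deriv ?_
  congr 1
  rw [Finset.mul_sum, ← Finset.sum_sub_distrib]
  refine Finset.sum_congr rfl fun i _ => ?_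
  rw [mul_div_cancel₀ _ (hz i)]
  ring

theorem IsLocalMinOn.sum_mul_log_sub_eq_zero {q : ℕ} [NeZero q] {β h : ℝ} {z : Fin q → ℝ}
    (hz : z ∈ simplex q) (hmin : IsLocalMinOn (freeEnergy q β h) (simplex q) z)
    {v : Fin q → ℝ} (hv : ∑ i, v i = 0) :
    ∑ i, v i * (Real.log (z i) - β * z i) - h * v 0 = 0 := by
  have hpos := hmin.simplex_pos hz
  have hc : Tendsto (fun t : ℝ => z + t • v) (𝓝 0) (𝓝[simplex q] z) := by
    refine tendsto_nhdsWithin_iff.2 ⟨?_, ?_⟩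
    · have : Continuous fun t : ℝ => z + t • v := by fun_prop
      simpa using this.tendsto 0
    · have : ∀ i, ∀ᶠ t : ℝ in 𝓝 0, 0 < z i + t * v i := fun i => by
        have h1 : Continuous fun t : ℝ => z i + t * v i := by fun_prop
        exact (h1.tendsto 0).eventually_const_lt (by simpa using hpos i)
      filter_upwards [eventually_all.2 this] with t ht
      exact add_smul_mem_simplex hz hv fun i => (ht i).le
  have h1 : IsLocalMin (fun t : ℝ => freeEnergy q β h (z + t • v)) 0 := by
    filter_upwards [hc.eventually hmin] with t ht
    simpa using ht
  have h2 := h1.hasDerivAt_eq_zero (hasDerivAt_freeEnergy_line fun i => by simpa using (hpos i).ne')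
  have h3 : ∑ i, v i * (Real.log (z i) - β * z i) =
      ∑ i, v i * (Real.log (z i + 0 * v i) + 1 - β * (z i + 0 * v i)) := by
    have h4 : ∀ i, v i * (Real.log (z i + 0 * v i) + 1 - β * (z i + 0 * v i)) =
        v i * (Real.log (z i) - β * z i) + v i := fun i => by rw [zero_mul, add_zero]; ring
    simp only [h4, Finset.sum_add_distrib, hv, add_zero]
  rw [h3, h2]

theorem IsLocalMinOn.log_sub_eq {q : ℕ} [NeZero q] {β h : ℝ} {z : Fin q → ℝ}
    (hz : z ∈ simplex q) (hmin : IsLocalMinOn (freeEnergy q β h) (simplex q) z) (i : Fin q) :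
    Real.log (z i) - β * z i - h * (if i = 0 then 1 else 0) = Real.log (z 0) - β * z 0 - h := by
  have h1 := hmin.sum_mul_log_sub_eq_zero hz
    (v := fun k => (if k = i then 1 else 0) - if k = 0 then 1 else 0) (by simp)
  simp only [sub_mul, Finset.sum_sub_distrib, ite_mul, one_mul, zero_mul, Finset.sum_ite_eq',
    Finset.mem_univ, if_true] at h1
  simp only [eq_comm (a := (0 : Fin q))] at h1
  linarith

theorem lt_of_deriv_deriv_neg {F G G' : ℝ → ℝ} {a d : ℝ} (had : a < d)
    (hF : ∀ s ∈ Set.Icc a d, HasDerivAt F (G s) s) (hG : ∀ s ∈ Set.Icc a d, HasDerivAt G (G' s) s)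
    (ha : G a = 0) (hG' : ∀ s ∈ Set.Ioo a d, G' s < 0) : F d < F a := by
  have h1 : StrictAntiOn G (Set.Icc a d) := by
    refine strictAntiOn_of_deriv_neg (convex_Icc a d)
      (fun s hs => (hG s hs).continuousAt.continuousWithinAt) fun s hs => ?_
    rw [interior_Icc] at hs
    rw [(hG s (Set.Ioo_subset_Icc_self hs)).deriv]
    exact hG' s hs
  have h2 : StrictAntiOn F (Set.Icc a d) := by
    refine strictAntiOn_of_deriv_neg (convex_Icc a d)
      (fun s hs => (hF s hs).continuousAt.continuousWithinAt) fun s hs => ?_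
    rw [interior_Icc] at hs
    rw [(hF s (Set.Ioo_subset_Icc_self hs)).deriv, ← ha]
    exact h1 (Set.left_mem_Icc.2 had.le) (Set.Ioo_subset_Icc_self hs) hs.1
  exact h2 (Set.left_mem_Icc.2 had.le) (Set.right_mem_Icc.2 had.le) had

theorem lt_of_deriv_deriv_neg' {F G G' : ℝ → ℝ} {a d : ℝ} (had : d < a)
    (hF : ∀ s ∈ Set.Icc d a, HasDerivAt F (G s) s) (hG : ∀ s ∈ Set.Icc d a, HasDerivAt G (G' s) s)
    (ha : G a = 0) (hG' : ∀ s ∈ Set.Ioo d a, G' s < 0) : F d < F a := by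
  have := lt_of_deriv_deriv_neg (F := fun s => F (-s)) (G := fun s => -G (-s))
    (G' := fun s => G' (-s)) (neg_lt_neg had)
    (fun s hs => by
      have := (hF (-s) ⟨by linarith [hs.2], by linarith [hs.1]⟩).scomp s (hasDerivAt_neg s)
      simpa [Function.comp_def] using this)
    (fun s hs => by
      have := ((hG (-s) ⟨by linarith [hs.2], by linarith [hs.1]⟩).scomp s
        (hasDerivAt_neg s)).fun_neg
      simpa [Function.comp_def] using this)
    (by simpa using ha) (fun s hs => hG' _ ⟨by linarith [hs.2], by linarith [hs.1]⟩)
  simpa using this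

theorem sum_eq_add_sub_one_mul {q : ℕ} [NeZero q] {g : Fin q → ℝ} {c : ℝ}
    (hg : ∀ i, i ≠ 0 → g i = c) : ∑ i, g i = g 0 + ((q : ℝ) - 1) * c := by
  rw [← Finset.add_sum_erase _ _ (Finset.mem_univ 0),
    Finset.sum_congr rfl fun i hi => hg i (Finset.ne_of_mem_erase hi), Finset.sum_const,
    Finset.card_erase_of_mem (Finset.mem_univ _), Finset.card_univ, Fintype.card_fin, nsmul_eq_mul,
    Nat.cast_pred (NeZero.pos q)]

theorem one_ne_zero_of_two_le {q : ℕ} [NeZero q] (hq : 2 ≤ q) : (1 : Fin q) ≠ 0 := by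
  rw [Ne, Fin.ext_iff, Fin.val_one', Fin.val_zero, Nat.mod_eq_of_lt hq]
  exact one_ne_zero

theorem curvature_pos {q : ℕ} [NeZero q] (hq : 2 ≤ q) {β h : ℝ} (hcrit : (β, h) ≠ (beta0 q, h0 q))
    {x : Fin q → ℝ} (hx : x ∈ simplex q)
    (hmin : ∀ y ∈ simplex q, freeEnergy q β h x ≤ freeEnergy q β h y)
    (hform : ∀ i : Fin q, i ≠ 0 → x i = x 1) : 0 < 1 / (x 0 * x 1) - q * β := by
  have hloc : IsLocalMinOn (freeEnergy q β h) (simplex q) x :=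
    eventually_nhdsWithin_of_forall hmin
  have hpos := hloc.simplex_pos hx
  obtain ⟨m, hm⟩ : ∃ m : ℝ, m = (q : ℝ) - 1 := ⟨_, rfl⟩
  have hq' : (2 : ℝ) ≤ q := by exact_mod_cast hq
  have hm0 : 0 < m := by linarith
  have hsum : x 0 + m * x 1 = 1 := by rw [hm, ← sum_eq_add_sub_one_mul hform, hx.2]
  obtain ⟨a, ha⟩ : ∃ a, a = x 0 := ⟨_, rfl⟩
  have hx1 : x 1 = (1 - a) / m := by rw [eq_div_iff hm0.ne']; linarith
  have ha0 : 0 < a := ha ▸ hpos 0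
  have ha1 : a < 1 := by nlinarith [hpos 1]
  let z : Fin q → ℝ := fun i => if i = 0 then 0 else 1 / m
  let v : Fin q → ℝ := fun i => if i = 0 then 1 else -1 / m
  have hzv : ∀ s i, z i + s * v i = if i = 0 then s else (1 - s) / m := by
    intro s i
    by_cases hi : i = 0
    · simp [z, v, hi]
    · simp only [z, v, if_neg hi]; ring
  let F : ℝ → ℝ := fun s => freeEnergy q β h (z + s • v)
  let G : ℝ → ℝ := fun s => Real.log s - Real.log ((1 - s) / m) - β * (s - (1 - s) / m) - h
  let G' : ℝ → ℝ := fun s => 1 / (s * (1 - s)) - β * (1 + 1 / m)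
  have hmem : ∀ s ∈ Set.Ioo (0 : ℝ) 1, z + s • v ∈ simplex q := by
    intro s hs
    have h1 : ∀ i, (z + s • v) i = if i = 0 then s else (1 - s) / m := hzv s
    refine ⟨fun i => ?_, ?_⟩
    · rw [h1]
      split_ifs
      · exact hs.1.le
      · exact div_nonneg (by linarith [hs.2]) hm0.le
    · rw [sum_eq_add_sub_one_mul (c := (1 - s) / m) fun i hi => by rw [h1, if_neg hi], h1,
        if_pos rfl, ← hm, mul_div_cancel₀ _ hm0.ne']
      ring
  have hxa : x = z + a • v := by
    funext i
    change x i = z i + a * v i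
    rw [hzv]
    split_ifs with hi
    · rw [hi, ha]
    · rw [hform i hi, hx1]
  have hF : ∀ s ∈ Set.Ioo (0 : ℝ) 1, HasDerivAt F (G s) s := by
    intro s hs
    have h1 : 0 < (1 - s) / m := div_pos (by linarith [hs.2]) hm0
    refine (hasDerivAt_freeEnergy_line fun i => ?_).congr_deriv ?_
    · rw [hzv]; split_ifs
      · exact hs.1.ne'
      · exact h1.ne'
    · simp only [hzv]
      rw [sum_eq_add_sub_one_mul
        (c := -1 / m * (Real.log ((1 - s) / m) + 1 - β * ((1 - s) / m)))
        fun i hi => by simp only [v, if_neg hi]]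
      simp only [v, if_pos, G, ← hm]
      field_simp
      ring
  have hG : ∀ s ∈ Set.Ioo (0 : ℝ) 1, HasDerivAt G (G' s) s := by
    intro s hs
    have h1 : 0 < (1 - s) / m := div_pos (by linarith [hs.2]) hm0
    have h2 : (1 - s) ≠ 0 := by linarith [hs.2]
    have h3 : HasDerivAt (fun s : ℝ => (1 - s) / m) (-1 / m) s :=
      ((hasDerivAt_id s).const_sub 1).div_const m
    have h4 := (((Real.hasDerivAt_log hs.1.ne').sub (h3.log h1.ne')).sub
      (((hasDerivAt_id s).sub h3).const_mul β)).sub_const h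
    refine h4.congr_deriv ?_
    have := hs.1.ne'
    simp only [G']
    field_simp
    ring
  have hmin' : ∀ s ∈ Set.Ioo (0 : ℝ) 1, F a ≤ F s := fun s hs => by
    have := hmin _ (hmem s hs)
    rwa [hxa] at this
  have hGa : G a = 0 := by
    refine IsLocalMin.hasDerivAt_eq_zero ?_ (hF a ⟨ha0, ha1⟩)
    filter_upwards [Ioo_mem_nhds ha0 ha1] with s hs using hmin' s hs
  have hκ : 1 / (x 0 * x 1) - q * β = m * G' a := by
    rw [← ha, hx1, show (q : ℝ) = m + 1 by linarith]
    have : 1 - a ≠ 0 := by linarith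
    simp only [G']
    field_simp
  rw [hκ]
  refine mul_pos hm0 ?_
  by_contra! hle
  have hsub : ∀ {c d : ℝ}, 0 < c → d < 1 → Set.Icc c d ⊆ Set.Ioo 0 1 := fun hc hd s hs =>
    ⟨hc.trans_le hs.1, hs.2.trans_lt hd⟩
  have hlt : ∀ s, 0 < s → s < 1 → a * (1 - a) < s * (1 - s) → G' s < 0 := by
    intro s hs0 hs1 hs
    have h1 := one_div_lt_one_div_of_lt (mul_pos ha0 (by linarith)) hs
    simp only [G'] at hle ⊢
    linarith
  rcases lt_trichotomy a (1 / 2) with h2 | h2 | h2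
  · have hs := hsub ha0 (by norm_num : (1 / 2 : ℝ) < 1)
    have := lt_of_deriv_deriv_neg h2 (fun s h => hF s (hs h)) (fun s h => hG s (hs h)) hGa
      fun s h => hlt s (by linarith [h.1]) (by linarith [h.2]) (by nlinarith [h.1, h.2])
    linarith [hmin' (1 / 2) (by norm_num)]
  · rcases hle.lt_or_eq with h3 | h3
    · have hcont : ContinuousAt G' a := by
        have : a * (1 - a) ≠ 0 := (mul_pos ha0 (by linarith)).ne'
        simp only [G']
        fun_prop (disch := exact this)
      obtain ⟨ε, hε, hε'⟩ := Metric.eventually_nhds_iff.1 (hcont.eventually_lt_const h3)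
      obtain ⟨c, hc1, hc2⟩ := exists_between (lt_min (lt_add_of_pos_right a hε) ha1)
      have hs := hsub ha0 (hc2.trans_le (min_le_right _ _))
      have := lt_of_deriv_deriv_neg hc1 (fun s h => hF s (hs h)) (fun s h => hG s (hs h)) hGa
        fun s h => hε' (by
          have := min_le_left (a + ε) 1
          rw [Real.dist_eq, abs_of_pos (by linarith [h.1])]; linarith [h.2])
      linarith [hmin' c (hs ⟨hc1.le, le_rfl⟩)]
    · apply hcrit
      have hβ : β = 4 * m / (m + 1) := by
        simp only [G', h2] at h3
        field_simp at h3 ⊢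
        linarith
      have hh : h = Real.log m - 2 * (m - 1) / (m + 1) := by
        simp only [G, h2] at hGa
        rw [show (1 - 1 / 2 : ℝ) / m = (1 / 2) / m by norm_num,
          Real.log_div (by norm_num) hm0.ne', hβ] at hGa
        have : 4 * m / (m + 1) * (1 / 2 - 1 / 2 / m) = 2 * (m - 1) / (m + 1) := by
          field_simp; ring
        linarith
      rw [Prod.mk.injEq, beta0, h0, ← hm, show (q : ℝ) - 2 = m - 1 by linarith,
        show (q : ℝ) = m + 1 by linarith]
      exact ⟨hβ, hh⟩
  · have hs := hsub (by norm_num : (0 : ℝ) < 1 / 2) ha1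
    have := lt_of_deriv_deriv_neg' h2 (fun s h => hF s (hs h)) (fun s h => hG s (hs h)) hGa
      fun s h => hlt s (by linarith [h.1]) (by linarith [h.2]) (by nlinarith [h.1, h.2])
    linarith [hmin' (1 / 2) (by norm_num)]

theorem freeEnergy_comp_swap {q : ℕ} [NeZero q] (β h : ℝ) (x : Fin q → ℝ) :
    freeEnergy q β h (x ∘ Equiv.swap 0 1) = freeEnergy q β h x + h * (x 0 - x 1) := by
  simp only [freeEnergy, Function.comp_apply, Equiv.swap_apply_left]
  rw [Equiv.sum_comp (Equiv.swap 0 1) fun i => x i * Real.log (x i),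
    Equiv.sum_comp (Equiv.swap 0 1) fun i => x i ^ 2]
  ring

theorem beta_lt_one_div {q : ℕ} [NeZero q] (hq : 2 ≤ q) {β h : ℝ} (hh : 0 ≤ h)
    (hcrit : (β, h) ≠ (beta0 q, h0 q)) {x : Fin q → ℝ} (hx : x ∈ simplex q)
    (hmin : ∀ y ∈ simplex q, freeEnergy q β h x ≤ freeEnergy q β h y)
    (huniq : ∀ y ∈ simplex q,
      (∀ z ∈ simplex q, freeEnergy q β h y ≤ freeEnergy q β h z) → y = x)
    (hform : ∀ i : Fin q, i ≠ 0 → x i = x 1) : 0 < 1 / x 1 - β := by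
  have hκ := curvature_pos hq hcrit hx hmin hform
  have hloc : IsLocalMinOn (freeEnergy q β h) (simplex q) x :=
    eventually_nhdsWithin_of_forall hmin
  have hpos := hloc.simplex_pos hx
  have hq' : (2 : ℝ) ≤ q := by exact_mod_cast hq
  have hswap : x ∘ Equiv.swap 0 1 ∈ simplex q :=
    ⟨fun i => hx.1 _, (Equiv.sum_comp (Equiv.swap 0 1) x).trans hx.2⟩
  have hfs := freeEnergy_comp_swap β h x
  rcases hh.eq_or_lt with rfl | hh
  · have h1 : x 0 = x 1 := by
      have := congrFun (huniq _ hswap fun z hz => by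
        rw [hfs, zero_mul, add_zero]; exact hmin z hz) 1
      simpa using this
    have hsum : q * x 1 = 1 := by
      have := sum_eq_add_sub_one_mul hform
      rw [hx.2, h1] at this
      linarith
    have hq1 : (q : ℝ) = 1 / x 1 := by rw [eq_div_iff (hpos 1).ne', hsum]
    rw [h1, hq1, ← one_div_mul_one_div, ← mul_sub] at hκ
    exact (mul_pos_iff_of_pos_left (one_div_pos.2 (hpos 1))).1 hκ
  · have hge : x 1 ≤ x 0 := by
      have := hmin _ hswap
      rw [hfs] at this
      nlinarith
    have hcr := hloc.log_sub_eq hx 1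
    rw [if_neg (one_ne_zero_of_two_le hq), mul_zero, sub_zero] at hcr
    have hlt : x 1 < x 0 := by
      refine hge.lt_of_ne fun hc => ?_
      rw [hc] at hcr
      linarith
    by_contra! hle
    have h1 : Real.log (x 0) - Real.log (x 1) ≤ x 0 / x 1 - 1 := by
      rw [← Real.log_div (hpos 0).ne' (hpos 1).ne']
      exact Real.log_le_sub_one_of_pos (div_pos (hpos 0) (hpos 1))
    have h2 : x 0 / x 1 - 1 = 1 / x 1 * (x 0 - x 1) := by
      have := (hpos 1).ne'
      field_simp
    nlinarith

theorem one_div_mul_sub_eq {q : ℕ} [NeZero q] {β : ℝ} {x : Fin q → ℝ} (hpos : ∀ i, 0 < x i)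
    (hsum : ∑ i, x i = 1) (hform : ∀ i : Fin q, i ≠ 0 → x i = x 1) :
    1 / (x 0 * x 1) - q * β = ((q : ℝ) - 1) * (1 / x 0 - β) + (1 / x 1 - β) := by
  have hs : x 0 + ((q : ℝ) - 1) * x 1 = 1 := by rw [← sum_eq_add_sub_one_mul hform, hsum]
  have : 1 / (x 0 * x 1) = ((q : ℝ) - 1) * (1 / x 0) + 1 / x 1 := by
    have := (hpos 0).ne'
    have := (hpos 1).ne'
    field_simp
    linarith
  rw [this]
  ring

theorem sum_sub_mul_sq_pos {q : ℕ} [NeZero q] {β : ℝ} {x : Fin q → ℝ} (hpos : ∀ i, 0 < x i)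
    (hsum : ∑ i, x i = 1) (hform : ∀ i : Fin q, i ≠ 0 → x i = x 1)
    (hκ : 0 < 1 / (x 0 * x 1) - q * β) (hB : 0 < 1 / x 1 - β)
    {w : Fin q → ℝ} (hw : w ≠ 0) (hw0 : ∑ i, w i = 0) : 0 < ∑ i, (1 / x i - β) * w i ^ 2 := by
  let s : Finset (Fin q) := Finset.univ.erase 0
  have hcard : (s.card : ℝ) = (q : ℝ) - 1 := by
    rw [Finset.card_erase_of_mem (Finset.mem_univ _), Finset.card_univ, Fintype.card_fin,
      Nat.cast_pred (NeZero.pos q)]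
  have h1 : w 0 = -∑ i ∈ s, w i := by
    rw [eq_neg_iff_add_eq_zero, Finset.add_sum_erase _ _ (Finset.mem_univ 0), hw0]
  have h2 : w 0 ^ 2 ≤ ((q : ℝ) - 1) * ∑ i ∈ s, w i ^ 2 := by
    rw [h1, neg_sq, ← hcard]
    exact sq_sum_le_card_mul_sum_sq
  have hT : 0 < ∑ i ∈ s, w i ^ 2 := by
    refine (Finset.sum_nonneg fun i _ => sq_nonneg _).lt_of_ne' fun hc => hw (funext fun i => ?_)
    by_cases hi : i = 0
    · rw [hc, mul_zero] at h2
      rw [hi]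
      exact pow_eq_zero_iff two_ne_zero |>.1 (le_antisymm h2 (sq_nonneg _))
    · exact pow_eq_zero_iff two_ne_zero |>.1 ((Finset.sum_eq_zero_iff_of_nonneg
        fun i _ => sq_nonneg _).1 hc i (Finset.mem_erase.2 ⟨hi, Finset.mem_univ _⟩))
  rw [← Finset.add_sum_erase _ _ (Finset.mem_univ 0),
    Finset.sum_congr rfl fun i hi => by rw [hform i (Finset.ne_of_mem_erase hi)], ← Finset.mul_sum]
  rw [one_div_mul_sub_eq hpos hsum hform] at hκ
  rcases le_total 0 (1 / x 0 - β) with hA | hA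
  · exact add_pos_of_nonneg_of_pos (mul_nonneg hA (sq_nonneg _)) (mul_pos hB hT)
  · have h3 := mul_le_mul_of_nonpos_left h2 hA
    have h4 := mul_pos hκ hT
    change 0 < _ + _ * ∑ i ∈ s, w i ^ 2
    linarith

theorem eventually_sum_mul_sq_nonneg {q : ℕ} {D : Fin q → ℝ}
    (hD : ∀ w : Fin q → ℝ, w ≠ 0 → ∑ i, w i = 0 → 0 < ∑ i, D i * w i ^ 2) :
    ∀ᶠ m in 𝓝 D, ∀ w : Fin q → ℝ, ∑ i, w i = 0 → 0 ≤ ∑ i, m i * w i ^ 2 := by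
  let K : Set (Fin q → ℝ) := Metric.sphere 0 1 ∩ {w | ∑ i, w i = 0}
  have hK : IsCompact K :=
    (isCompact_sphere 0 1).inter_right (isClosed_eq (by fun_prop) continuous_const)
  have h1 : ∀ᶠ m in 𝓝 D, ∀ w ∈ K, 0 < ∑ i, m i * w i ^ 2 := by
    refine hK.eventually_forall_of_forall_eventually fun w hw => ?_
    have hc : Continuous fun p : (Fin q → ℝ) × (Fin q → ℝ) => ∑ i, p.1 i * p.2 i ^ 2 := by fun_prop
    refine (hc.tendsto _).eventually_const_lt (hD w (fun h => ?_) hw.2)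
    have := hw.1
    simp [h] at this
  filter_upwards [h1] with m hm w hw
  by_cases hw0 : w = 0
  · simp [hw0]
  have hn : ‖w‖ ≠ 0 := norm_ne_zero_iff.2 hw0
  have := hm (‖w‖⁻¹ • w) ⟨by simp [norm_smul, hn], by simp [← Finset.mul_sum, hw]⟩
  have h2 : ∑ i, m i * (‖w‖⁻¹ • w) i ^ 2 = ‖w‖⁻¹ ^ 2 * ∑ i, m i * w i ^ 2 := by
    rw [Finset.mul_sum]
    exact Finset.sum_congr rfl fun i _ => by simp only [Pi.smul_apply, smul_eq_mul]; ring
  rw [h2] at this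
  exact (pos_of_mul_pos_right this (sq_nonneg _)).le

theorem isCompact_simplex (q : ℕ) : IsCompact (simplex q) := isCompact_stdSimplex ℝ (Fin q)

theorem continuous_freeEnergy (q : ℕ) [NeZero q] :
    Continuous fun p : (ℝ × ℝ) × (Fin q → ℝ) => freeEnergy q p.1.1 p.1.2 p.2 := by
  have h : ∀ i : Fin q, Continuous fun p : (ℝ × ℝ) × (Fin q → ℝ) => p.2 i * Real.log (p.2 i) :=
    fun i => Real.continuous_mul_log.comp (by fun_prop)
  unfold freeEnergy
  fun_prop

theorem tendsto_of_forall_isMin {q : ℕ} [NeZero q] {β h : ℝ} {βseq hseq : ℕ → ℝ}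
    (hβs : Tendsto βseq atTop (𝓝 β)) (hhs : Tendsto hseq atTop (𝓝 h)) {x : Fin q → ℝ}
    (hx : x ∈ simplex q)
    (hmin : ∀ y ∈ simplex q, freeEnergy q β h x ≤ freeEnergy q β h y)
    (huniq : ∀ y ∈ simplex q,
      (∀ z ∈ simplex q, freeEnergy q β h y ≤ freeEnergy q β h z) → y = x)
    {y : ℕ → Fin q → ℝ} (hy : ∀ n, y n ∈ simplex q)
    (hymin : ∀ n, ∀ z ∈ simplex q,
      freeEnergy q (βseq n) (hseq n) (y n) ≤ freeEnergy q (βseq n) (hseq n) z) :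
    Tendsto y atTop (𝓝 x) := by
  refine tendsto_nhds.2 fun U hU hxU => ?_
  have hK : IsCompact (simplex q \ U) := (isCompact_simplex q).diff hU
  have h1 : ∀ᶠ p : ℝ × ℝ in 𝓝 (β, h), ∀ z ∈ simplex q \ U,
      freeEnergy q p.1 p.2 x < freeEnergy q p.1 p.2 z := by
    refine hK.eventually_forall_of_forall_eventually fun z hz => ?_
    have hlt : freeEnergy q β h x < freeEnergy q β h z := by
      refine lt_of_not_ge fun hle => hz.2 ?_
      rw [huniq z hz.1 fun w hw => hle.trans (hmin w hw)]
      exact hxU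
    have hc := continuous_freeEnergy q
    have hc' : Continuous fun p : (ℝ × ℝ) × (Fin q → ℝ) => freeEnergy q p.1.1 p.1.2 x :=
      hc.comp (f := fun p : (ℝ × ℝ) × (Fin q → ℝ) => (p.1, x)) (by fun_prop)
    exact (hc'.tendsto ((β, h), z)).eventually_lt (hc.tendsto ((β, h), z)) hlt
  filter_upwards [(hβs.prodMk_nhds hhs).eventually h1] with n hn
  by_contra hc
  exact (hn (y n) ⟨hy n, hc⟩).not_ge (hymin n x hx)

theorem tendsto_localMin_of_minimal {q : ℕ} [NeZero q] {β h : ℝ} {βseq hseq : ℕ → ℝ}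
    (hβs : Tendsto βseq atTop (𝓝 β)) (hhs : Tendsto hseq atTop (𝓝 h)) {x : Fin q → ℝ}
    (hx : x ∈ simplex q)
    (hmin : ∀ y ∈ simplex q, freeEnergy q β h x ≤ freeEnergy q β h y)
    (huniq : ∀ y ∈ simplex q,
      (∀ z ∈ simplex q, freeEnergy q β h y ≤ freeEnergy q β h z) → y = x)
    {d : ℕ → Fin q → ℝ}
    (hd : ∀ n, ∀ d' : Fin q → ℝ, (∑ i, d' i = 0) → (x + d') ∈ simplex q →
        IsLocalMinOn (freeEnergy q (βseq n) (hseq n)) (simplex q) (x + d') →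
        ∑ i, (d n i) ^ 2 ≤ ∑ i, (d' i) ^ 2) :
    Tendsto (fun n => x + d n) atTop (𝓝 x) := by
  have hex : ∀ n, ∃ y ∈ simplex q, ∀ z ∈ simplex q,
      freeEnergy q (βseq n) (hseq n) y ≤ freeEnergy q (βseq n) (hseq n) z := fun n =>
    (isCompact_simplex q).exists_isMinOn ⟨x, hx⟩ ((continuous_freeEnergy q).comp
      (f := fun y : Fin q → ℝ => ((βseq n, hseq n), y)) (by fun_prop)).continuousOn
  choose y hy hymin using hex
  have hyx := tendsto_of_forall_isMin hβs hhs hx hmin huniq hy hymin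
  have h1 : ∀ n, ∑ i, d n i ^ 2 ≤ ∑ i, (y n i - x i) ^ 2 := fun n => by
    refine hd n (y n - x) ?_ ?_ ?_
    · simp [(hy n).2, hx.2]
    · simpa using hy n
    · rw [add_sub_cancel]
      exact eventually_nhdsWithin_of_forall (hymin n)
  have h2 : Tendsto (fun n => ∑ i, (y n i - x i) ^ 2) atTop (𝓝 0) := by
    have hc : Continuous fun y : Fin q → ℝ => ∑ i, (y i - x i) ^ 2 := by fun_prop
    simpa [Function.comp_def] using (hc.tendsto x).comp hyx
  have h3 : Tendsto d atTop (𝓝 0) := by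
    refine tendsto_pi_nhds.2 fun i => ?_
    have h4 : Tendsto (fun n => d n i ^ 2) atTop (𝓝 0) :=
      squeeze_zero (fun n => sq_nonneg _) (fun n => (Finset.single_le_sum
        (f := fun i => d n i ^ 2) (fun j _ => sq_nonneg _) (Finset.mem_univ i)).trans (h1 n)) h2
    have h5 := h4.sqrt
    simp only [Real.sqrt_sq_eq_abs, Real.sqrt_zero] at h5
    exact (tendsto_zero_iff_abs_tendsto_zero _).2 h5
  simpa using h3.const_add x

theorem sq_div_le_mul_log_sub {y z : ℝ} (hy : 0 < y) (hz : 0 < z) :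
    (y - z) ^ 2 / (2 * max y z) ≤ y * Real.log y - y * Real.log z - y + z := by
  rw [← mul_sub, ← Real.log_div hy.ne' hz.ne']
  rcases le_total y z with h | h
  · rw [max_eq_right h]
    have h1 : Real.log (z / y) ≤ Real.sinh (Real.log (z / y)) :=
      Real.self_le_sinh_iff.2 (Real.log_nonneg ((one_le_div hy).2 h))
    rw [Real.sinh_log (div_pos hz hy), inv_div] at h1
    rw [← inv_div z y, Real.log_inv]
    have h2 := mul_le_mul_of_nonneg_left h1 hy.le
    have h3 : (y - z) ^ 2 / (2 * z) = -(y * ((z / y - y / z) / 2)) - y + z := by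
      field_simp
      ring
    linarith
  · rw [max_eq_left h]
    have h1 := Real.le_log_one_add_of_nonneg (x := (y - z) / z) (div_nonneg (by linarith) hz.le)
    rw [show 1 + (y - z) / z = y / z by field_simp; ring,
      show 2 * ((y - z) / z) / ((y - z) / z + 2) = 2 * (y - z) / (y + z) by
        have : y + z ≠ 0 := by linarith
        have : (y - z) / z + 2 = (y + z) / z := by field_simp; ring
        rw [this]
        field_simp] at h1
    have h2 := mul_le_mul_of_nonneg_left h1 hy.le
    have h3 : y * (2 * (y - z) / (y + z)) - y + z = (y - z) ^ 2 / (y + z) := by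
      field_simp
      ring
    have h4 : (y - z) ^ 2 / (2 * y) ≤ (y - z) ^ 2 / (y + z) :=
      div_le_div_of_nonneg_left (sq_nonneg _) (by linarith) (by linarith)
    linarith

theorem eventually_le_relEntropy {q : ℕ} [NeZero q] {β h : ℝ} {x : Fin q → ℝ} (hx : x ∈ simplex q)
    (hmin : ∀ y ∈ simplex q, freeEnergy q β h x ≤ freeEnergy q β h y)
    (huniq : ∀ y ∈ simplex q,
      (∀ z ∈ simplex q, freeEnergy q β h y ≤ freeEnergy q β h z) → y = x)
    (hQ : ∀ w : Fin q → ℝ, w ≠ 0 → ∑ i, w i = 0 → 0 < ∑ i, (1 / x i - β) * w i ^ 2) :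
    ∀ᶠ p : (Fin q → ℝ) × ℝ in 𝓝 (x, β), ∀ y ∈ simplex q, p.1 ∈ simplex q →
      p.2 / 2 * ∑ i, (y i - p.1 i) ^ 2 ≤
        ∑ i, (y i * Real.log (y i) - y i * Real.log (p.1 i)) := by
  have hloc : IsLocalMinOn (freeEnergy q β h) (simplex q) x :=
    eventually_nhdsWithin_of_forall hmin
  have hpos := hloc.simplex_pos hx
  suffices h : ∀ᶠ p : (Fin q → ℝ) × ℝ in 𝓝 (x, β), ∀ y ∈ simplex q, y ∈ simplex q →
      p.1 ∈ simplex q → p.2 / 2 * ∑ i, (y i - p.1 i) ^ 2 ≤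
        ∑ i, (y i * Real.log (y i) - y i * Real.log (p.1 i)) from
    h.mono fun p hp y hy => hp y hy hy
  refine (isCompact_simplex q).eventually_forall_of_forall_eventually fun y hy => ?_
  by_cases hyx : y = x
  · rw [hyx]
    have hm : Tendsto (fun p : ((Fin q → ℝ) × ℝ) × (Fin q → ℝ) =>
        fun i => 1 / max (p.2 i) (p.1.1 i) - p.1.2) (𝓝 ((x, β), x)) (𝓝 fun i => 1 / x i - β) := by
      refine tendsto_pi_nhds.2 fun i => ?_
      have : ContinuousAt (fun p : ((Fin q → ℝ) × ℝ) × (Fin q → ℝ) =>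
          1 / max (p.2 i) (p.1.1 i) - p.1.2) ((x, β), x) := by
        have : max (x i) (x i) ≠ 0 := by simpa using (hpos i).ne'
        fun_prop (disch := exact this)
      simpa [ContinuousAt] using this
    have hp1 : ∀ i, ∀ᶠ p : ((Fin q → ℝ) × ℝ) × (Fin q → ℝ) in 𝓝 ((x, β), x),
        0 < p.2 i ∧ 0 < p.1.1 i := fun i => by
      have h1 : Continuous fun p : ((Fin q → ℝ) × ℝ) × (Fin q → ℝ) => p.2 i := by fun_prop
      have h2 : Continuous fun p : ((Fin q → ℝ) × ℝ) × (Fin q → ℝ) => p.1.1 i := by fun_prop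
      exact ((h1.tendsto _).eventually_const_lt (hpos i)).and
        ((h2.tendsto _).eventually_const_lt (hpos i))
    filter_upwards [hm.eventually (eventually_sum_mul_sq_nonneg hQ), eventually_all.2 hp1]
      with p h1 h2 hy hz
    have h3 := h1 (p.2 - p.1.1) (by simp [hy.2, hz.2])
    have h4 := Finset.sum_le_sum fun i (_ : i ∈ Finset.univ) =>
      sq_div_le_mul_log_sub (h2 i).1 (h2 i).2
    rw [Finset.sum_add_distrib, Finset.sum_sub_distrib _ p.2, hy.2, hz.2, sub_add_cancel] at h4
    refine le_trans ?_ h4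
    rw [← sub_nonneg]
    have h5 : ∀ i, (p.2 i - p.1.1 i) ^ 2 / (2 * max (p.2 i) (p.1.1 i)) -
        p.1.2 / 2 * (p.2 i - p.1.1 i) ^ 2 =
        1 / 2 * ((1 / max (p.2 i) (p.1.1 i) - p.1.2) * (p.2 - p.1.1) i ^ 2) := fun i => by
      rw [Pi.sub_apply, mul_comm 2, ← div_div]
      ring
    rw [Finset.mul_sum, ← Finset.sum_sub_distrib, Finset.sum_congr rfl fun i _ => h5 i,
      ← Finset.mul_sum]
    exact mul_nonneg (by norm_num) h3
  · have hlt : freeEnergy q β h x < freeEnergy q β h y :=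
      lt_of_not_ge fun hle => hyx (huniq y hy fun w hw => hle.trans (hmin w hw))
    have hc1 : ContinuousAt (fun p : ((Fin q → ℝ) × ℝ) × (Fin q → ℝ) =>
        p.1.2 / 2 * ∑ i, (p.2 i - p.1.1 i) ^ 2) ((x, β), y) := by fun_prop
    have hc2 : ContinuousAt (fun p : ((Fin q → ℝ) × ℝ) × (Fin q → ℝ) =>
        ∑ i, (p.2 i * Real.log (p.2 i) - p.2 i * Real.log (p.1.1 i))) ((x, β), y) := by
      refine tendsto_finsetSum _ fun i _ => ContinuousAt.sub ?_ ?_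
      · exact (Real.continuous_mul_log.comp
          (f := fun p : ((Fin q → ℝ) × ℝ) × (Fin q → ℝ) => p.2 i) (by fun_prop)).continuousAt
      · have : x i ≠ 0 := (hpos i).ne'
        fun_prop (disch := exact this)
    have hcr := hloc.sum_mul_log_sub_eq_zero hx (v := y - x) (by simp [hy.2, hx.2])
    have hkey : β / 2 * ∑ i, (y i - x i) ^ 2 + (freeEnergy q β h y - freeEnergy q β h x) =
        ∑ i, (y i * Real.log (y i) - y i * Real.log (x i)) := by
      have h1 : ∀ i, y i * Real.log (y i) - y i * Real.log (x i) = β / 2 * (y i - x i) ^ 2 +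
          (y i * Real.log (y i) - β / 2 * y i ^ 2) - (x i * Real.log (x i) - β / 2 * x i ^ 2) -
          (y - x) i * (Real.log (x i) - β * x i) := fun i => by rw [Pi.sub_apply]; ring
      rw [Finset.sum_congr rfl fun i _ => h1 i]
      simp only [Finset.sum_sub_distrib, Finset.sum_add_distrib, ← Finset.mul_sum]
      rw [sub_eq_zero.1 hcr, Pi.sub_apply, freeEnergy, freeEnergy]
      ring
    refine (hc1.eventually_lt hc2 ?_).mono fun p hp _ _ => hp.le
    change β / 2 * ∑ i, (y i - x i) ^ 2 < ∑ i, (y i * Real.log (y i) - y i * Real.log (x i))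
    linarith

theorem sum_mul_exp_le_of_le_relEntropy {q : ℕ} {z : Fin q → ℝ} (hz : ∀ i, 0 < z i)
    (hne : 0 < q) {c : ℝ} (hc : 0 < c)
    (hent : ∀ y ∈ simplex q, c / 2 * ∑ i, (y i - z i) ^ 2 ≤
      ∑ i, (y i * Real.log (y i) - y i * Real.log (z i))) (u : Fin q → ℝ) :
    ∑ k, z k * Real.exp (u k) ≤ Real.exp (∑ k, u k * z k + (∑ k, u k ^ 2) / (2 * c)) := by
  obtain ⟨S, hS⟩ : ∃ S, S = ∑ k, z k * Real.exp (u k) := ⟨_, rfl⟩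
  have hS0 : 0 < S := hS ▸ Finset.sum_pos (fun k _ => mul_pos (hz k) (Real.exp_pos _))
    ⟨⟨0, hne⟩, Finset.mem_univ _⟩
  rw [← hS, ← Real.log_le_iff_le_exp hS0]
  let y : Fin q → ℝ := fun k => z k * Real.exp (u k) / S
  have hy1 : ∑ k, y k = 1 := by
    rw [← Finset.sum_div, ← hS, div_self hS0.ne']
  have hy : ∀ k, 0 < y k := fun k => div_pos (mul_pos (hz k) (Real.exp_pos _)) hS0
  have h1 := hent y ⟨fun k => (hy k).le, hy1⟩
  have h2 : ∀ i, y i * Real.log (y i) - y i * Real.log (z i) = y i * u i - y i * Real.log S := by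
    intro i
    have : Real.log (y i) = Real.log (z i) + u i - Real.log S := by
      rw [Real.log_div (mul_pos (hz i) (Real.exp_pos _)).ne' hS0.ne',
        Real.log_mul (hz i).ne' (Real.exp_pos _).ne', Real.log_exp]
    rw [this]
    ring
  simp only [h2] at h1
  rw [Finset.sum_sub_distrib, ← Finset.sum_mul, hy1, one_mul] at h1
  have h3 : ∑ i, y i * u i ≤
      ∑ k, (u k * z k + u k ^ 2 / (2 * c) + c / 2 * (y k - z k) ^ 2) := by
    refine Finset.sum_le_sum fun k _ => ?_
    have h4 : u k * z k + u k ^ 2 / (2 * c) + c / 2 * (y k - z k) ^ 2 - y k * u k =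
        (u k - c * (y k - z k)) ^ 2 / (2 * c) := by
      field_simp
      ring
    have h5 : 0 ≤ (u k - c * (y k - z k)) ^ 2 / (2 * c) := by positivity
    linarith
  rw [Finset.sum_add_distrib, Finset.sum_add_distrib, ← Finset.sum_div, ← Finset.mul_sum] at h3
  linarith

theorem sum_colorCount_sq {q n : ℕ} (σ : Fin n → Fin q) :
    ∑ p ∈ Finset.univ.filter (fun p : Fin n × Fin n => p.1 < p.2),
      (if σ p.1 = σ p.2 then (1 : ℝ) else 0) = (∑ k, (colorCount σ k : ℝ) ^ 2 - n) / 2 := by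
  let F : Fin n × Fin n → ℝ := fun p => if σ p.1 = σ p.2 then 1 else 0
  have h1 : ∑ p, F p = ∑ k, (colorCount σ k : ℝ) ^ 2 := by
    simp only [sq]
    rw [sum_colorCount_mul σ fun k => (colorCount σ k : ℝ), Fintype.sum_prod_type]
    refine Finset.sum_congr rfl fun i _ => ?_
    simp only [F, colorCount, Finset.sum_boole, eq_comm]
  have h2 : ∑ p ∈ Finset.univ.filter (fun p : Fin n × Fin n => p.2 < p.1), F p =
      ∑ p ∈ Finset.univ.filter (fun p : Fin n × Fin n => p.1 < p.2), F p := by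
    refine Finset.sum_nbij' Prod.swap Prod.swap (by simp) (by simp) (by simp) (by simp)
      fun p _ => ?_
    simp only [F, Prod.fst_swap, Prod.snd_swap, eq_comm]
  have h3 : ∑ p ∈ Finset.univ.filter (fun p : Fin n × Fin n => p.1 = p.2), F p = n := by
    rw [Finset.sum_filter, Fintype.sum_prod_type]
    simp [F]
  have h4 : ∑ p, F p = ∑ p ∈ Finset.univ.filter (fun p : Fin n × Fin n => p.1 < p.2), F p +
      (∑ p ∈ Finset.univ.filter (fun p : Fin n × Fin n => p.1 = p.2), F p +
        ∑ p ∈ Finset.univ.filter (fun p : Fin n × Fin n => p.2 < p.1), F p) := by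
    simp only [Finset.sum_filter, ← Finset.sum_add_distrib]
    refine Finset.sum_congr rfl fun p _ => ?_
    rcases lt_trichotomy p.1 p.2 with h | h | h
    · simp [h, h.ne, h.not_gt]
    · simp [h]
    · simp [h, h.ne', h.not_gt]
  rw [h2, h3, h1] at h4
  change ∑ p ∈ _, F p = _
  linarith

theorem cwWeight_eq {q n : ℕ} [NeZero q] (hn : n ≠ 0) {β h L : ℝ} {z : Fin q → ℝ}
    (hz : ∀ k, 0 < z k) (hlog : ∀ k, Real.log (z k) = β * z k + h * (if k = 0 then 1 else 0) + L)
    (σ : Fin n → Fin q) :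
    cwWeight q n β h σ = Real.exp (-(β / 2) - n * L - β * n / 2 * ∑ k, z k ^ 2) *
      ((∏ i, z (σ i)) * Real.exp (β / 2 * ∑ k, countDev z σ k ^ 2)) := by
  have hn' : (0 : ℝ) < n := by positivity
  have h1 : ∏ i, z (σ i) = Real.exp (β * ∑ k, (colorCount σ k : ℝ) * z k +
      h * ∑ i, (if σ i = 0 then (1 : ℝ) else 0) + n * L) := by
    rw [sum_colorCount_mul, ← Finset.prod_congr rfl fun i _ => Real.exp_log (hz (σ i)),
      ← Real.exp_sum, Finset.sum_congr rfl fun i _ => hlog (σ i)]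
    simp only [Finset.sum_add_distrib, Finset.mul_sum, Finset.sum_const, Finset.card_univ,
      Fintype.card_fin, nsmul_eq_mul]
  have h2 : ∑ k, countDev z σ k ^ 2 = (∑ k, (colorCount σ k : ℝ) ^ 2) / n -
      2 * ∑ k, (colorCount σ k : ℝ) * z k + n * ∑ k, z k ^ 2 := by
    rw [Finset.sum_div, Finset.mul_sum, Finset.mul_sum, ← Finset.sum_sub_distrib,
      ← Finset.sum_add_distrib]
    refine Finset.sum_congr rfl fun k _ => ?_
    rw [countDev, div_pow, Real.sq_sqrt hn'.le]
    field_simp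
    ring
  rw [cwWeight, sum_colorCount_sq, h1, h2, ← Real.exp_add, ← Real.exp_add]
  congr 1
  field_simp
  ring

theorem cwExp_eq {q n : ℕ} [NeZero q] (hn : n ≠ 0) {β h L : ℝ} {z : Fin q → ℝ}
    (hz : ∀ k, 0 < z k) (hlog : ∀ k, Real.log (z k) = β * z k + h * (if k = 0 then 1 else 0) + L)
    (g : (Fin n → Fin q) → ℝ) :
    cwExp q n β h g =
      (∑ σ : Fin n → Fin q, (∏ i, z (σ i)) * (Real.exp (β / 2 * ∑ k, countDev z σ k ^ 2) * g σ)) /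
        ∑ σ : Fin n → Fin q, (∏ i, z (σ i)) * Real.exp (β / 2 * ∑ k, countDev z σ k ^ 2) := by
  rw [cwExp, cwZ, Finset.sum_congr rfl fun σ _ => cwWeight_eq hn hz hlog σ, ← Finset.mul_sum,
    Finset.sum_congr rfl fun σ _ => by rw [cwWeight_eq hn hz hlog σ, mul_assoc, mul_assoc],
    ← Finset.mul_sum, mul_div_mul_left _ _ (Real.exp_pos _).ne']

theorem covMatrix_mulVec {q : ℕ} [NeZero q] {A B : ℝ} (hB : B ≠ 0) (hκ : ((q : ℝ) - 1) * A + B ≠ 0)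
    {K : Matrix (Fin q) (Fin q) ℝ}
    (hK : K = Matrix.of fun i j =>
      (((q : ℝ) - 1) * A + B)⁻¹ *
        (if i = 0 ∧ j = 0 then (q : ℝ) - 1
         else if i = 0 ∨ j = 0 then -1
         else if i = j then 1 + ((q : ℝ) - 2) * (A / B)
         else -(A / B)))
    (w : Fin q → ℝ) :
    ∑ i, K.mulVec w i = 0 ∧
      ∃ θ, ∀ i, (if i = 0 then A else B) * K.mulVec w i = w i - θ := by
  have h0 : K.mulVec w 0 = (((q : ℝ) - 1) * A + B)⁻¹ * (q * w 0 - ∑ j, w j) := by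
    have h1 : ∀ j, K 0 j * w j = (((q : ℝ) - 1) * A + B)⁻¹ *
        (q * (if j = 0 then w j else 0) - w j) := fun j => by
      rw [hK, Matrix.of_apply]
      by_cases hj : j = 0
      · simp [hj]; ring
      · simp [hj]
    simp only [Matrix.mulVec, dotProduct, h1, ← Finset.mul_sum, Finset.sum_sub_distrib,
      Finset.sum_ite_eq', Finset.mem_univ, if_true]
  have hi : ∀ i, i ≠ 0 → K.mulVec w i = (((q : ℝ) - 1) * A + B)⁻¹ *
      ((1 + ((q : ℝ) - 1) * (A / B)) * w i - (1 - A / B) * w 0 - A / B * ∑ j, w j) := by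
    intro i hi
    have h1 : ∀ j, K i j * w j = (((q : ℝ) - 1) * A + B)⁻¹ *
        ((1 + ((q : ℝ) - 1) * (A / B)) * (if i = j then w j else 0) -
          (1 - A / B) * (if j = 0 then w j else 0) - A / B * w j) := fun j => by
      rw [hK, Matrix.of_apply]
      by_cases hj : j = 0
      · simp [hj, hi]; ring
      · by_cases hij : i = j
        · simp [hij, hj]; ring
        · simp [hij, hj, hi]; ring
    simp only [Matrix.mulVec, dotProduct, h1, ← Finset.mul_sum, Finset.sum_sub_distrib,
      Finset.sum_ite_eq', Finset.sum_ite_eq, Finset.mem_univ, if_true]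
  refine ⟨?_, (((q : ℝ) - 1) * A + B)⁻¹ * (A * ∑ j, w j + (B - A) * w 0), fun i => ?_⟩
  · rw [← Finset.add_sum_erase _ _ (Finset.mem_univ 0), h0,
      Finset.sum_congr rfl fun i h => hi i (Finset.ne_of_mem_erase h), ← Finset.mul_sum,
      Finset.sum_sub_distrib, Finset.sum_sub_distrib, ← Finset.mul_sum, Finset.sum_const,
      Finset.sum_const, Finset.card_erase_of_mem (Finset.mem_univ _), Finset.card_univ,
      Fintype.card_fin, nsmul_eq_mul, nsmul_eq_mul, Nat.cast_pred (NeZero.pos q),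
      ← Finset.add_sum_erase _ w (Finset.mem_univ 0)]
    ring
  · split_ifs with h
    · rw [h, h0]
      linear_combination w 0 * mul_inv_cancel₀ hκ
    · rw [hi i h]
      field_simp
      ring

theorem rank_eq_of_mulVec {q : ℕ} [NeZero q] {D : Fin q → ℝ}
    (hD : ∀ w : Fin q → ℝ, w ≠ 0 → ∑ i, w i = 0 → 0 < ∑ i, D i * w i ^ 2)
    {K : Matrix (Fin q) (Fin q) ℝ} (hK0 : ∀ w, ∑ i, K.mulVec w i = 0)
    (hK : ∀ w, ∃ θ, ∀ i, D i * K.mulVec w i = w i - θ) : K.rank = q - 1 := by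
  have h1 : K.mulVec (fun _ => 1) = 0 := by
    by_contra hc
    obtain ⟨θ, hθ⟩ := hK fun _ => 1
    have h2 : ∑ i, D i * K.mulVec (fun _ => 1) i ^ 2 = 0 := by
      rw [Finset.sum_congr rfl fun i _ => show D i * K.mulVec (fun _ => 1) i ^ 2 =
        (1 - θ) * K.mulVec (fun _ => 1) i by rw [sq, ← mul_assoc, hθ], ← Finset.mul_sum, hK0,
        mul_zero]
    exact (hD _ hc (hK0 _)).ne' h2
  have h2 : LinearMap.ker K.mulVecLin = Submodule.span ℝ {fun _ => 1} := by
    refine le_antisymm (fun w hw => ?_) ?_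
    · obtain ⟨θ, hθ⟩ := hK w
      have hw : K.mulVec w = 0 := hw
      refine Submodule.mem_span_singleton.2 ⟨θ, funext fun i => ?_⟩
      have := hθ i
      rw [hw, Pi.zero_apply, mul_zero] at this
      simp only [Pi.smul_apply, smul_eq_mul]
      linarith
    · rw [Submodule.span_singleton_le_iff_mem]
      exact h1
  have h3 : (fun _ => 1 : Fin q → ℝ) ≠ 0 := fun h => one_ne_zero (congrFun h 0)
  have h4 := LinearMap.finrank_range_add_finrank_ker K.mulVecLin
  rw [h2, finrank_span_singleton h3, Module.finrank_fin_fun] at h4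
  rw [Matrix.rank]
  omega

/-- Gaussian fluctuations of the empirical vector around the unique
global minimizer `x = (x_1, x_q, …, x_q)` away from `(β_0,h_0)`:
`W = (N − nx − n d_n)/√n` converges in law to the centered Gaussian with covariance
`K = (1/(x_1 x_q) − qβ)⁻¹ M`, a matrix of rank `q − 1`. -/
theorem stmt_13 (q : ℕ) [NeZero q] (hq : 2 ≤ q) (β h : ℝ) (hβ : 0 ≤ β) (hh : 0 ≤ h)
    (hcrit : (β, h) ≠ (beta0 q, h0 q))
    (βseq hseq : ℕ → ℝ)
    (hβs : Tendsto βseq atTop (𝓝 β)) (hhs : Tendsto hseq atTop (𝓝 h))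
    (x : Fin q → ℝ) (hx : x ∈ simplex q)
    (hmin : ∀ y ∈ simplex q, freeEnergy q β h x ≤ freeEnergy q β h y)
    (huniq : ∀ y ∈ simplex q,
      (∀ z ∈ simplex q, freeEnergy q β h y ≤ freeEnergy q β h z) → y = x)
    (hform : ∀ i : Fin q, i ≠ 0 → x i = x 1)
    (d : ℕ → Fin q → ℝ)
    (hd : ∀ n : ℕ, (∑ i, d n i = 0) ∧ (x + d n) ∈ simplex q ∧
      IsLocalMinOn (freeEnergy q (βseq n) (hseq n)) (simplex q) (x + d n) ∧
      ∀ d' : Fin q → ℝ, (∑ i, d' i = 0) → (x + d') ∈ simplex q →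
        IsLocalMinOn (freeEnergy q (βseq n) (hseq n)) (simplex q) (x + d') →
        ∑ i, (d n i) ^ 2 ≤ ∑ i, (d' i) ^ 2)
    (K : Matrix (Fin q) (Fin q) ℝ)
    (hK : K = Matrix.of fun i j =>
      (1 / (x 0 * x 1) - q * β)⁻¹ *
        (if i = 0 ∧ j = 0 then (q : ℝ) - 1
         else if i = 0 ∨ j = 0 then -1
         else if i = j then 1 + ((q : ℝ) - 2) * ((1 / x 0 - β) / (1 / x 1 - β))
         else -((1 / x 0 - β) / (1 / x 1 - β)))) :
    ∃ ν : Measure (Fin q → ℝ), IsCenteredGaussianWithCov q K ν ∧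
      (∀ g : (Fin q → ℝ) → ℝ, Continuous g → (∃ C : ℝ, ∀ y, |g y| ≤ C) →
        Tendsto (fun n : ℕ => cwExp q n (βseq n) (hseq n) (fun σ =>
            g (fun k => ((colorCount σ k : ℝ) - n * x k - n * d n k) / Real.sqrt n)))
          atTop (𝓝 (∫ y, g y ∂ν))) ∧
      K.rank = q - 1 := by
  have hloc : IsLocalMinOn (freeEnergy q β h) (simplex q) x :=
    eventually_nhdsWithin_of_forall hmin
  have hpos := hloc.simplex_pos hx
  have hκ := curvature_pos hq hcrit hx hmin hform
  have hB := beta_lt_one_div hq hh hcrit hx hmin huniq hform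
  have hQ : ∀ w : Fin q → ℝ, w ≠ 0 → ∑ i, w i = 0 → 0 < ∑ i, (1 / x i - β) * w i ^ 2 :=
    fun w hw hw0 => sum_sub_mul_sq_pos hpos hx.2 hform hκ hB hw hw0
  have hκ' : 1 / (x 0 * x 1) - q * β = ((q : ℝ) - 1) * (1 / x 0 - β) + (1 / x 1 - β) :=
    one_div_mul_sub_eq hpos hx.2 hform
  have hKw := covMatrix_mulVec hB.ne' (hκ' ▸ hκ.ne') (hκ' ▸ hK)
  have hD : ∀ i, (if i = 0 then 1 / x 0 - β else 1 / x 1 - β) = 1 / x i - β := fun i => by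
    split_ifs with hi
    · rw [hi]
    · rw [hform i hi]
  simp only [hD] at hKw
  have hDC : ∀ a w : Fin q → ℝ, ∑ i, w i = 0 →
      ∑ i, (1 / x i - β) * K.mulVec a i * w i = ∑ i, a i * w i := fun a w hw => by
    obtain ⟨θ, hθ⟩ := (hKw a).2
    simp only [hθ, sub_mul, Finset.sum_sub_distrib, ← Finset.mul_sum, hw, mul_zero, sub_zero]
  let C₀ : (Fin q → ℝ) → Fin q → ℝ := fun a i => x i * (a i - ∑ j, a j * x j)
  have hC₀ : ∀ a, ∑ i, C₀ a i = 0 := fun a => by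
    simp only [C₀, mul_sub, Finset.sum_sub_distrib, ← Finset.sum_mul, hx.2]
    rw [one_mul, sub_eq_zero]
    exact Finset.sum_congr rfl fun i _ => mul_comm _ _
  have hDC₀ : ∀ a w : Fin q → ℝ, ∑ i, w i = 0 →
      ∑ i, 1 / x i * C₀ a i * w i = ∑ i, a i * w i := fun a w hw => by
    have h1 : ∀ i, 1 / x i * C₀ a i = a i - ∑ j, a j * x j := fun i => by
      rw [← mul_assoc, one_div_mul_cancel (hpos i).ne', one_mul]
    simp only [h1, sub_mul, Finset.sum_sub_distrib, ← Finset.mul_sum, hw, mul_zero, sub_zero]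
  have hC₀a : ∀ a, ∑ i, a i * C₀ a i = ∑ k, x k * (a k - ∑ j, a j * x j) ^ 2 := fun a => by
    rw [← sub_eq_zero, ← Finset.sum_sub_distrib, ← mul_zero (∑ j, a j * x j), ← hC₀ a,
      Finset.mul_sum]
    refine Finset.sum_congr rfl fun i _ => ?_
    simp only [C₀]
    ring
  obtain ⟨γ, ν, hγ, hν, hγchar, hInt, hνint, hνmap⟩ :=
    exists_gaussian_and_tilt q (fun i => 1 / x i) hβ hQ C₀ K.mulVec hC₀ (fun a => (hKw a).1) hDC₀
      hDC
  refine ⟨ν, ⟨hν, fun a => ?_⟩, ?_, rank_eq_of_mulVec hQ (fun w => (hKw w).1) fun w => (hKw w).2⟩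
  · rw [hνmap]
    simp only [Matrix.mulVec, dotProduct, Finset.mul_sum, mul_assoc]
  rintro g hg ⟨M, hM⟩
  let z : ℕ → Fin q → ℝ := fun n => x + d n
  have hzx : Tendsto z atTop (𝓝 x) :=
    tendsto_localMin_of_minimal hβs hhs hx hmin huniq fun n => (hd n).2.2.2
  have hz : ∀ n, z n ∈ simplex q := fun n => (hd n).2.1
  have hzpos : ∀ n k, 0 < z n k := fun n => (hd n).2.2.1.simplex_pos (hz n)
  obtain ⟨c, hβc, hc⟩ : ∃ c, β < c ∧ ∀ᶠ n in atTop, ∀ y ∈ simplex q,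
      c / 2 * ∑ i, (y i - z n i) ^ 2 ≤
        ∑ i, (y i * Real.log (y i) - y i * Real.log (z n i)) := by
    obtain ⟨P, hP, R, hR, hPR⟩ :=
      eventually_prod_iff.1 (nhds_prod_eq (x := x) (y := β) ▸
        eventually_le_relEntropy hx hmin huniq hQ)
    obtain ⟨c, hc, hβc⟩ := ((hR.filter_mono nhdsWithin_le_nhds).and
      (self_mem_nhdsWithin (a := β) (s := Set.Ioi β))).exists
    exact ⟨c, hβc, (hzx.eventually hP).mono fun n hn y hy => hPR hn hc y hy (hz n)⟩
  obtain ⟨b, hβb, hbc⟩ := exists_between hβc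
  let p : ∀ n, (Fin n → Fin q) → ℝ := fun n σ => ∏ i, z n (σ i)
  have hp : ∀ n σ, 0 ≤ p n σ := fun n σ => Finset.prod_nonneg fun i _ => (hzpos n _).le
  have hA : ∀ᶠ n in atTop, ∑ σ, p n σ * Real.exp (b / 2 * ∑ k, countDev (z n) σ k ^ 2) ≤
      (∫ u, diagWeight (fun _ : Fin q => 1 - b / c) u) /
        ∫ u, diagWeight (fun _ : Fin q => 1) u := by
    filter_upwards [hc, eventually_ne_atTop 0] with n hn hn0
    exact sum_prod_mul_exp_sq_countDev_le hn0 (hz n).1 (hβ.trans hβb.le) hbc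
      (sum_mul_exp_le_of_le_relEntropy (hzpos n) (NeZero.pos q) (hβ.trans_lt hβc) hn)
  have hweak : ∀ g : (Fin q → ℝ) → ℝ, Continuous g → ∀ C : ℝ, (∀ y, |g y| ≤ C) →
      Tendsto (fun n => ∑ σ, p n σ * g (countDev (z n) σ)) atTop (𝓝 (∫ y, g y ∂γ)) := by
    intro g hg C hC
    refine tendsto_sum_of_tendsto_charFun p (fun n σ => countDev (z n) σ) hp
      (fun n => sum_prod_eq_one (hz n).2) γ (fun a => ?_) g hg C hC
    rw [hγchar, hC₀a]
    exact tendsto_charFun_countDev (fun n => (hz n).2) hzx a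
  have htilt : ∀ g : (Fin q → ℝ) → ℝ, Continuous g → ∀ C : ℝ, (∀ y, |g y| ≤ C) →
      Tendsto (fun n => ∑ σ, p n σ * (Real.exp (βseq n / 2 * ∑ k, countDev (z n) σ k ^ 2) *
        g (countDev (z n) σ))) atTop
      (𝓝 (∫ y, Real.exp (β / 2 * ∑ i, y i ^ 2) * g y ∂γ)) := fun g hg C hC =>
    tendsto_sum_tilt p (fun n σ => countDev (z n) σ) hp γ hweak hβs hβb hA hInt g hg C hC
  have h1 := htilt (fun _ => 1) continuous_const 1 (by simp)
  simp only [mul_one] at h1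
  rw [hνint g hg]
  refine ((htilt g hg M hM).div h1 (integral_exp_pos hInt).ne').congr' ?_
  filter_upwards [eventually_ne_atTop 0] with n hn
  have hL : ∀ k, Real.log (z n k) = βseq n * z n k + hseq n * (if k = 0 then 1 else 0) +
      (Real.log (z n 0) - βseq n * z n 0 - hseq n) := fun k => by
    have := (hd n).2.2.1.log_sub_eq (hz n) k
    change Real.log (z n k) - βseq n * z n k - _ = Real.log (z n 0) - βseq n * z n 0 - hseq n
      at this
    linarith
  have hW : ∀ σ : Fin n → Fin q, (fun k => ((colorCount σ k : ℝ) - n * x k - n * d n k) /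
      Real.sqrt n) = countDev (z n) σ := fun σ => funext fun k => by
    simp only [countDev, z, Pi.add_apply]
    ring
  simp only [hW]
  exact (cwExp_eq hn (hzpos n) hL _).symm
end
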